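/- The number of rooted planar quadrangulations with n faces equals (2/(n+2)) * (3^n/(n+1)) * binomial(2n, n). -/

import Mathlib

/-- A rooted combinatorial map on the dart set `Fin D`: a vertex-rotation
permutation `σ`, an edge involution `α` without fixed points pairing the two
darts of each edge, a root dart, and connectivity of the underlying graph
(the group generated by `σ` and `α` acts transitively on darts).  Faces are
the cycles of `σ * α`. -/
structure RootedMap (D : ℕ) where
  σ : Equiv.Perm (Fin D)
  α : Equiv.Perm (Fin D)
  root : Fin D
  α_invol : ∀ d, α (α d) = d
  α_fpf : ∀ d, α d ≠ d
  connected : ∀ d e : Fin D,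
    ∃ g ∈ Subgroup.closure ({σ, α} : Set (Equiv.Perm (Fin D))), g d = e

/-- Isomorphism of rooted maps: a relabelling of darts commuting with the two
permutations and preserving the root. -/
def MapIso {D : ℕ} (M M' : RootedMap D) : Prop :=
  ∃ e : Equiv.Perm (Fin D), (∀ d, e (M.σ d) = M'.σ (e d)) ∧
    (∀ d, e (M.α d) = M'.α (e d)) ∧ e M.root = M'.root

/-- The number of orbits (cycles, including fixed points) of a permutation:
the number of vertices when applied to `σ`, of faces when applied to `σ * α`. -/
noncomputable def orbitCount {m : ℕ} (π : Equiv.Perm (Fin m)) : ℕ :=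
  Nat.card (MulAction.orbitRel.Quotient (Subgroup.zpowers π) (Fin m))

/-- The number of orbits of size `i` of a permutation: the number of vertices of
degree `i` when `π` is the vertex rotation of a combinatorial map. -/
noncomputable def orbitCountOfSize {m : ℕ} (π : Equiv.Perm (Fin m)) (i : ℕ) : ℕ :=
  Nat.card {o : MulAction.orbitRel.Quotient (Subgroup.zpowers π) (Fin m) //
    Nat.card o.orbit = i}

/-- A rooted planar quadrangulation with `n` faces: a rooted map on `4n` darts
(`2n` edges) all of whose faces have degree exactly `4` and whose Euler
characteristic is `2`, i.e. `v + f = 2n + 2`. -/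
def IsPlanarQuad {n : ℕ} (M : RootedMap (4 * n)) : Prop :=
  (∀ d, ((M.σ * M.α) ^ 4) d = d ∧ (M.σ * M.α) d ≠ d ∧ ((M.σ * M.α) ^ 2) d ≠ d) ∧
  orbitCount M.σ + orbitCount (M.σ * M.α) = 2 * n + 2

namespace PlanarQuad

open Equiv Equiv.Perm

section Setoids

variable {X : Type*}

/-- The orbit equivalence relation of a permutation. -/
def cyc (π : Perm X) : Setoid X := SameCycle.setoid π

/-- The number of classes of an equivalence relation. -/
noncomputable def numClasses (s : Setoid X) : ℕ := Nat.card (Quotient s)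

/-- The size of the class of a point. -/
noncomputable def classSize (s : Setoid X) (x : X) : ℕ := Nat.card {y // s x y}

lemma cyc_rel {π : Perm X} {x y : X} : cyc π x y ↔ π.SameCycle x y := Iff.rfl

lemma cyc_apply (π : Perm X) (x : X) : cyc π x (π x) := ⟨1, by simp⟩

lemma cyc_le_iff {π : Perm X} {s : Setoid X} : cyc π ≤ s ↔ ∀ x, s x (π x) := by
  refine ⟨fun h x => h (cyc_apply π x), fun h x y hxy => ?_⟩
  obtain ⟨k, rfl⟩ := hxy
  induction k generalizing x with
  | zero => simp
  | succ n ih =>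
    rw [zpow_add, zpow_one, Perm.mul_apply]
    exact s.trans (h x) (ih (π x))
  | pred n ih =>
    rw [zpow_sub, zpow_one, Perm.mul_apply]
    refine s.trans (s.symm ?_) (ih _)
    simpa using h (π⁻¹ x)

lemma sup_left_rel {s t : Setoid X} {x y : X} (h : s x y) : (s ⊔ t) x y :=
  (le_sup_left : s ≤ s ⊔ t) h

lemma sup_right_rel {s t : Setoid X} {x y : X} (h : t x y) : (s ⊔ t) x y :=
  (le_sup_right : t ≤ s ⊔ t) h

lemma cyc_one : cyc (1 : Perm X) = ⊥ := by
  refine le_bot_iff.1 (cyc_le_iff.2 fun x => ?_)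
  simp

lemma cyc_mul_le (π ρ : Perm X) : cyc (π * ρ) ≤ cyc π ⊔ cyc ρ :=
  cyc_le_iff.2 fun x => (cyc π ⊔ cyc ρ).trans (sup_right_rel (cyc_apply ρ x))
    (sup_left_rel (cyc_apply π (ρ x)))

lemma fixed_of_cyc {π : Perm X} {x y : X} (hx : π x = x) (h : cyc π x y) : x = y := by
  obtain ⟨k, rfl⟩ := h
  exact (zpow_apply_eq_self_of_apply_eq_self hx k).symm

/-- A set stable under a permutation of a finite type is a union of orbits. -/
lemma cyc_mem_of_stable [Finite X] {π : Perm X} {T : Set X} (h : ∀ x ∈ T, π x ∈ T) {x y : X}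
    (hxy : cyc π x y) (hx : x ∈ T) : y ∈ T := by
  obtain ⟨i, rfl⟩ := hxy.exists_nat_pow_eq
  clear hxy
  induction i with
  | zero => simpa
  | succ n ih => rw [pow_succ', Perm.mul_apply]; exact h _ ih

lemma numClasses_bot : numClasses (⊥ : Setoid X) = Nat.card X :=
  (Nat.card_congr (Equiv.ofBijective (Quotient.mk (⊥ : Setoid X))
    ⟨fun _ _ h => Quotient.exact h, Quotient.mk_surjective⟩)).symm

/-- The equivalence relation whose classes are the connected components of a map. -/
def comp (φ α : Perm X) : Setoid X := cyc φ ⊔ cyc α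

variable [DecidableEq X]

lemma cyc_swap_rel (a b : X) : cyc (swap a b) a b := by
  simpa using cyc_apply (swap a b) a

lemma cyc_swap_le_iff {a b : X} {s : Setoid X} : cyc (swap a b) ≤ s ↔ s a b := by
  refine ⟨fun h => h (cyc_swap_rel a b), fun h => cyc_le_iff.2 fun x => ?_⟩
  by_cases hxa : x = a
  · subst hxa; simpa using h
  by_cases hxb : x = b
  · subst hxb; simpa using s.symm h
  · rw [swap_apply_of_ne_of_ne hxa hxb]

lemma sup_swap_rel {s : Setoid X} {a b x y : X} :
    (s ⊔ cyc (swap a b)) x y ↔ s x y ∨ (s x a ∧ s b y) ∨ (s x b ∧ s a y) := by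
  constructor
  · intro h
    let t : Setoid X :=
      { r := fun x y => s x y ∨ (s x a ∧ s b y) ∨ (s x b ∧ s a y)
        iseqv :=
          { refl := fun x => Or.inl (s.refl x)
            symm := by
              rintro x y (h | ⟨h, h'⟩ | ⟨h, h'⟩)
              · exact Or.inl (s.symm h)
              · exact Or.inr (Or.inr ⟨s.symm h', s.symm h⟩)
              · exact Or.inr (Or.inl ⟨s.symm h', s.symm h⟩)
            trans := by
              rintro x y z (h | ⟨h, h'⟩ | ⟨h, h'⟩) (k | ⟨k, k'⟩ | ⟨k, k'⟩)
              · exact Or.inl (s.trans h k)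
              · exact Or.inr (Or.inl ⟨s.trans h k, k'⟩)
              · exact Or.inr (Or.inr ⟨s.trans h k, k'⟩)
              · exact Or.inr (Or.inl ⟨h, s.trans h' k⟩)
              · exact Or.inr (Or.inl ⟨h, k'⟩)
              · exact Or.inl (s.trans h k')
              · exact Or.inr (Or.inr ⟨h, s.trans h' k⟩)
              · exact Or.inl (s.trans h k')
              · exact Or.inr (Or.inr ⟨h, k'⟩) } }
    have h1 : s ≤ t := fun x y h => Or.inl h
    have h2 : cyc (swap a b) ≤ t :=
      cyc_swap_le_iff.2 (Or.inr (Or.inl ⟨s.refl a, s.refl b⟩))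
    exact sup_le h1 h2 h
  · have hab : (s ⊔ cyc (swap a b)) a b := sup_right_rel (cyc_swap_rel a b)
    rintro (h | ⟨h, h'⟩ | ⟨h, h'⟩)
    · exact sup_left_rel h
    · exact Setoid.trans' _ (sup_left_rel h) (Setoid.trans' _ hab (sup_left_rel h'))
    · exact Setoid.trans' _ (sup_left_rel h)
        (Setoid.trans' _ (Setoid.symm' _ hab) (sup_left_rel h'))

lemma sup_swap_eq {s : Setoid X} {a b : X} (h : s a b) : s ⊔ cyc (swap a b) = s :=
  sup_eq_left.2 (cyc_swap_le_iff.2 h)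

/-- Joining two distinct classes decreases the number of classes by one. -/
lemma numClasses_sup_swap [Finite X] {s : Setoid X} {a b : X} (h : ¬ s a b) :
    numClasses (s ⊔ cyc (swap a b)) + 1 = numClasses s := by
  classical
  set t := s ⊔ cyc (swap a b) with ht
  let f : {q : Quotient s // q ≠ Quotient.mk s b} → Quotient t :=
    fun q => Quotient.map' (s₁ := s) (s₂ := t) id (fun x y hxy => sup_left_rel hxy) q.1
  have hf : Function.Bijective f := by
    constructor
    · rintro ⟨q, hq⟩ ⟨q', hq'⟩ hqq
      induction q using Quotient.inductionOn with | _ x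
      induction q' using Quotient.inductionOn with | _ y
      have hxy : t x y := Quotient.exact hqq
      have hx : ¬ s x b := fun h => hq (Quotient.sound h)
      have hy : ¬ s y b := fun h => hq' (Quotient.sound h)
      rcases sup_swap_rel.1 hxy with h | ⟨_, h⟩ | ⟨h, _⟩
      · exact Subtype.ext (Quotient.sound h)
      · exact absurd (s.symm h) hy
      · exact absurd h hx
    · intro q
      induction q using Quotient.inductionOn with | _ x
      by_cases hx : s x b
      · refine ⟨⟨Quotient.mk s a, fun h' => h (Quotient.exact h')⟩, Quotient.sound ?_⟩
        exact sup_swap_rel.2 (Or.inr (Or.inl ⟨s.refl a, s.symm hx⟩))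
      · exact ⟨⟨Quotient.mk s x, fun h' => hx (Quotient.exact h')⟩, rfl⟩
  have h1 := Nat.card_congr (Equiv.ofBijective f hf)
  have h2 := Nat.card_congr (Equiv.optionSubtypeNe (Quotient.mk s b))
  rw [Finite.card_option] at h2
  unfold numClasses
  rw [← h1, ← h2]

lemma numClasses_le_sup_swap [Finite X] (s : Setoid X) (a b : X) :
    numClasses s ≤ numClasses (s ⊔ cyc (swap a b)) + 1 := by
  by_cases h : s a b
  · rw [sup_swap_eq h]; omega
  · rw [numClasses_sup_swap h]

/-- Multiplying by a transposition of two points in the same cycle separates them. -/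
lemma not_cyc_mul_swap [Finite X] {π : Perm X} {a b : X} (hab : a ≠ b) (h : cyc π a b) :
    ¬ cyc (π * swap a b) a b := by
  classical
  have hex : ∃ j : ℕ, (π ^ j) a = b := SameCycle.exists_nat_pow_eq h
  let j := Nat.find hex
  have hj : (π ^ j) a = b := Nat.find_spec hex
  have hmin : ∀ i < j, (π ^ i) a ≠ b := fun i hi => Nat.find_min hex hi
  have ha : ∀ i, 0 < i → i ≤ j → (π ^ i) a ≠ a := by
    intro i hi hij hia
    refine hmin (j - i) (by omega) ?_
    conv_lhs => rw [← hia]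
    rw [← Perm.mul_apply, ← pow_add, Nat.sub_add_cancel hij, hj]
  have hj0 : 0 < j := by
    rcases Nat.eq_zero_or_pos j with h0 | h0
    · rw [h0] at hj; exact absurd hj hab
    · exact h0
  let T : Set X := {x | ∃ i, 0 < i ∧ i ≤ j ∧ (π ^ i) a = x}
  intro hc
  have : a ∈ T := by
    refine cyc_mem_of_stable (T := T) ?_ (SameCycle.symm hc) ⟨j, hj0, le_rfl, hj⟩
    rintro x ⟨i, hi, hij, rfl⟩
    rcases hij.eq_or_lt with rfl | hlt
    · exact ⟨1, one_pos, hj0, by simp [hj]⟩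
    · refine ⟨i + 1, by omega, hlt, ?_⟩
      rw [Perm.mul_apply, swap_apply_of_ne_of_ne (ha i hi hij) (hmin i hlt), pow_succ',
        Perm.mul_apply]
  obtain ⟨i, hi, hij, hia⟩ := this
  exact ha i hi hij hia

/-- Multiplying by a transposition of two points in distinct cycles merges them. -/
lemma cyc_mul_swap_rel [Finite X] {π : Perm X} {a b : X} (h : ¬ cyc π a b) :
    cyc (π * swap a b) a b := by
  classical
  have hex : ∃ k : ℕ, 0 < k ∧ (π ^ k) b = b :=
    ⟨orderOf π, orderOf_pos π, by rw [pow_orderOf_eq_one]; rfl⟩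
  let k := Nat.find hex
  obtain ⟨hk0, hk⟩ : 0 < k ∧ (π ^ k) b = b := Nat.find_spec hex
  have hmin : ∀ i < k, 0 < i → (π ^ i) b ≠ b := fun i hi h0 h' =>
    Nat.find_min hex hi ⟨h0, h'⟩
  have key : ∀ i, i + 1 ≤ k → ((π * swap a b) ^ (i + 1)) a = (π ^ (i + 1)) b := by
    intro i
    induction i with
    | zero => intro _; simp
    | succ i ih =>
      intro hi
      rw [pow_succ', Perm.mul_apply, ih (by omega), Perm.mul_apply, swap_apply_of_ne_of_ne]
      · rw [← Perm.mul_apply, ← pow_succ']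
      · intro h'
        exact h (SameCycle.symm ⟨((i + 1 : ℕ) : ℤ), by rw [zpow_natCast, h']⟩)
      · exact hmin _ (by omega) (by omega)
  refine ⟨(k : ℤ), ?_⟩
  obtain ⟨i, hi⟩ : ∃ i, k = i + 1 := ⟨k - 1, by omega⟩
  rw [zpow_natCast, hi, key i hi.ge, ← hi, hk]

lemma cyc_mul_swap_of_not [Finite X] {π : Perm X} {a b : X} (h : ¬ cyc π a b) :
    cyc (π * swap a b) = cyc π ⊔ cyc (swap a b) := by
  refine le_antisymm (cyc_mul_le _ _) (sup_le ?_ (cyc_swap_le_iff.2 (cyc_mul_swap_rel h)))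
  conv_lhs => rw [← mul_swap_mul_self a b π]
  refine (cyc_mul_le _ _).trans (sup_le le_rfl (cyc_swap_le_iff.2 (cyc_mul_swap_rel h)))

lemma numClasses_cyc_mul_swap_of_not [Finite X] {π : Perm X} {a b : X} (h : ¬ cyc π a b) :
    numClasses (cyc (π * swap a b)) + 1 = numClasses (cyc π) := by
  rw [cyc_mul_swap_of_not h, numClasses_sup_swap h]

lemma cyc_eq_sup_of_rel [Finite X] {π : Perm X} {a b : X} (hab : a ≠ b) (h : cyc π a b) :
    cyc π = cyc (π * swap a b) ⊔ cyc (swap a b) := by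
  rw [← cyc_mul_swap_of_not (not_cyc_mul_swap hab h), mul_swap_mul_self]

lemma numClasses_cyc_mul_swap_of_rel [Finite X] {π : Perm X} {a b : X} (hab : a ≠ b)
    (h : cyc π a b) : numClasses (cyc (π * swap a b)) = numClasses (cyc π) + 1 := by
  rw [← numClasses_cyc_mul_swap_of_not (not_cyc_mul_swap hab h), mul_swap_mul_self]

lemma comp_mul_swap_sup (φ α : Perm X) (a b : X) :
    comp φ (α * swap a b) ⊔ cyc (swap a b) = comp φ α ⊔ cyc (swap a b) := by
  unfold comp
  rw [sup_assoc, sup_assoc]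
  congr 1
  refine le_antisymm (sup_le (cyc_mul_le _ _) le_sup_right) (sup_le ?_ le_sup_right)
  conv_lhs => rw [← mul_swap_mul_self a b α]
  exact cyc_mul_le _ _

/-- The genus inequality for a pair of permutations. -/
theorem genus_le [Finite X] (φ α : Perm X) :
    numClasses (cyc φ) + numClasses (cyc α) + numClasses (cyc (φ * α)) ≤
      Nat.card X + 2 * numClasses (comp φ α) := by
  induction hm : Nat.card X - numClasses (cyc α) using Nat.strong_induction_on generalizing α with
  | _ m ih
  by_cases h1 : α = 1
  · subst h1
    rw [comp, cyc_one, mul_one, numClasses_bot, sup_bot_eq]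
    omega
  · obtain ⟨a, ha⟩ : ∃ a, α a ≠ a := by
      by_contra! hc
      exact h1 (Equiv.ext hc)
    have hrel : cyc α a (α a) := cyc_apply α a
    have hN := numClasses_cyc_mul_swap_of_rel ha.symm hrel
    have hle : numClasses (cyc (α * swap a (α a))) ≤ Nat.card X :=
      Nat.card_le_card_of_surjective _ Quotient.mk_surjective
    have hi := ih _ (by omega) (α * swap a (α a)) rfl
    have hsup := comp_mul_swap_sup φ α a (α a)
    rw [sup_swap_eq (s := comp φ α) (sup_right_rel hrel)] at hsup
    rw [← mul_assoc] at hi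
    by_cases hc : cyc (φ * α * swap a (α a)) a (α a)
    · have h2 := numClasses_cyc_mul_swap_of_rel ha.symm hc
      rw [mul_swap_mul_self] at h2
      have h3 : comp φ (α * swap a (α a)) a (α a) := by
        have := cyc_mul_le φ (α * swap a (α a))
        rw [← mul_assoc] at this
        exact this hc
      rw [sup_swap_eq h3] at hsup
      rw [← hsup]
      omega
    · have h2 := numClasses_cyc_mul_swap_of_not hc
      rw [mul_swap_mul_self] at h2
      have h3 := numClasses_le_sup_swap (comp φ (α * swap a (α a))) a (α a)
      rw [hsup] at h3
      omega

end Setoids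

section ClassSizes

variable {X : Type*}

lemma classSize_congr {s t : Setoid X} {x y : X} (h : ∀ z, s x z ↔ t y z) :
    classSize s x = classSize t y :=
  Nat.card_congr (Equiv.subtypeEquivRight h)

lemma classSize_eq_of_rel {s : Setoid X} {x y : X} (h : s x y) : classSize s x = classSize s y :=
  classSize_congr fun _ => ⟨s.trans (s.symm h), s.trans h⟩

lemma classSize_eq_one {s : Setoid X} {x : X} (h : ∀ y, s x y → x = y) : classSize s x = 1 := by
  have : Unique {y // s x y} := ⟨⟨⟨x, s.refl x⟩⟩, fun y => Subtype.ext (h _ y.2).symm⟩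
  exact Nat.card_unique

lemma classSize_pos [Finite X] (s : Setoid X) (x : X) : 0 < classSize s x :=
  haveI : Nonempty {y // s x y} := ⟨⟨x, s.refl x⟩⟩
  Nat.card_pos

lemma classSize_sup_swap [Finite X] [DecidableEq X] {s : Setoid X} {a b : X} (h : ¬ s a b) :
    classSize (s ⊔ cyc (swap a b)) a = classSize s a + classSize s b := by
  classical
  unfold classSize
  rw [← Nat.card_sum]
  refine Nat.card_congr ((Equiv.subtypeEquivRight fun z => ?_).trans
    (subtypeOrEquiv (fun z => s a z) (fun z => s b z) ?_))
  · rw [sup_swap_rel]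
    have h' : ∀ z, s a b ∧ s a z ↔ False := fun z => by simp [h]
    simp [h']
  · rw [Pi.disjoint_iff]
    intro z
    simp only [Prop.disjoint_iff]
    by_contra! hc
    exact h (s.trans hc.1 (s.symm hc.2))

lemma sup_swap_rel_of_not [DecidableEq X] {s : Setoid X} {a b x : X} (ha : ¬ s x a) (hb : ¬ s x b)
    (z : X) : (s ⊔ cyc (swap a b)) x z ↔ s x z := by
  rw [sup_swap_rel]
  simp [ha, hb]

/-- The number of classes is the sum of the inverses of the class sizes. -/
lemma numClasses_eq_sum [Fintype X] (s : Setoid X) :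
    (numClasses s : ℚ) = ∑ x, (classSize s x : ℚ)⁻¹ := by
  classical
  rw [← Finset.sum_fiberwise (s := Finset.univ) (g := fun x => Quotient.mk s x), numClasses,
    Nat.card_eq_fintype_card, Fintype.card_eq_sum_ones, Nat.cast_sum]
  refine Finset.sum_congr rfl fun q _ => ?_
  induction q using Quotient.inductionOn with | _ a
  have h1 : ∀ x ∈ Finset.univ.filter (fun x => Quotient.mk s x = Quotient.mk s a),
      (classSize s x : ℚ)⁻¹ = (classSize s a : ℚ)⁻¹ := by
    intro x hx
    rw [classSize_eq_of_rel (Quotient.exact (Finset.mem_filter.1 hx).2)]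
  rw [Finset.sum_congr rfl h1, Finset.sum_const]
  have h2 : (Finset.univ.filter (fun x => Quotient.mk s x = Quotient.mk s a)).card
      = classSize s a := by
    rw [classSize, Nat.card_eq_fintype_card, Fintype.card_subtype]
    congr 1
    ext x
    simp only [Finset.mem_filter, Finset.mem_univ, true_and]
    exact ⟨fun h => s.symm (Quotient.exact h), fun h => Quotient.sound (s.symm h)⟩
  rw [h2, nsmul_eq_mul, mul_inv_cancel₀]
  · simp
  · exact_mod_cast (classSize_pos s a).ne'

lemma sup_rel_of_disjoint {s t : Setoid X}
    (h : ∀ x, (∀ y, s x y → x = y) ∨ (∀ y, t x y → x = y)) {x y : X} :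
    (s ⊔ t) x y ↔ s x y ∨ t x y := by
  constructor
  · intro hxy
    let u : Setoid X :=
      { r := fun x y => s x y ∨ t x y
        iseqv :=
          { refl := fun x => Or.inl (s.refl x)
            symm := fun h => h.imp s.symm t.symm
            trans := by
              rintro x y z (h1 | h1) (h2 | h2)
              · exact Or.inl (s.trans h1 h2)
              · rcases h y with hy | hy
                · rw [← hy _ (s.symm h1)]; exact Or.inr h2
                · rw [← hy _ h2]; exact Or.inl h1
              · rcases h y with hy | hy
                · rw [← hy _ h2]; exact Or.inr h1
                · rw [← hy _ (t.symm h1)]; exact Or.inl h2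
              · exact Or.inr (t.trans h1 h2) } }
    have h1 : s ≤ u := fun _ _ => Or.inl
    have h2 : t ≤ u := fun _ _ => Or.inr
    exact sup_le h1 h2 hxy
  · rintro (h | h)
    exacts [sup_left_rel h, sup_right_rel h]

lemma numClasses_sup_of_disjoint [Finite X] {s t : Setoid X}
    (h : ∀ x, (∀ y, s x y → x = y) ∨ (∀ y, t x y → x = y)) :
    numClasses (s ⊔ t) + Nat.card X = numClasses s + numClasses t := by
  have := Fintype.ofFinite X
  have key : (numClasses (s ⊔ t) : ℚ) + Nat.card X = numClasses s + numClasses t := by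
    rw [numClasses_eq_sum, numClasses_eq_sum, numClasses_eq_sum, Nat.card_eq_fintype_card,
      Fintype.card_eq_sum_ones, Nat.cast_sum, ← Finset.sum_add_distrib, ← Finset.sum_add_distrib]
    refine Finset.sum_congr rfl fun x _ => ?_
    rcases h x with hx | hx
    · rw [classSize_eq_one hx, classSize_congr (s := s ⊔ t) (t := t) (y := x), add_comm]
      · simp
      · intro z
        rw [sup_rel_of_disjoint h]
        exact ⟨fun h' => h'.elim (fun h' => by rw [← hx _ h']) id, Or.inr⟩
    · rw [classSize_eq_one hx, classSize_congr (s := s ⊔ t) (t := s) (y := x)]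
      · simp
      · intro z
        rw [sup_rel_of_disjoint h]
        exact ⟨fun h' => h'.elim id (fun h' => by rw [← hx _ h']), Or.inl⟩
  exact_mod_cast key

lemma classSize_cyc [Finite X] (π : Perm X) (x : X) :
    classSize (cyc π) x = Function.minimalPeriod π x := by
  have h1 : Function.minimalPeriod π x = Nat.card (MulAction.orbit (Subgroup.zpowers π) x) := by
    have := Fintype.ofFinite (MulAction.orbit (Subgroup.zpowers π) x)
    rw [Nat.card_eq_fintype_card]
    exact MulAction.minimalPeriod_eq_card (a := π) (b := x)
  rw [h1]
  refine Nat.card_congr (Equiv.subtypeEquivRight fun y => ?_)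
  rw [MulAction.mem_orbit_iff]
  constructor
  · rintro ⟨k, hk⟩
    exact ⟨⟨π ^ k, k, rfl⟩, hk⟩
  · rintro ⟨⟨_, k, rfl⟩, hk⟩
    exact ⟨k, hk⟩

lemma classSize_cyc_eq_four_iff [Finite X] {π : Perm X} {x : X} :
    classSize (cyc π) x = 4 ↔ (π ^ 4) x = x ∧ (π ^ 2) x ≠ x := by
  have key : ∀ n, (π ^ n) x = x ↔ classSize (cyc π) x ∣ n := by
    intro n
    rw [classSize_cyc, ← Function.isPeriodicPt_iff_minimalPeriod_dvd, Function.IsPeriodicPt,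
      Function.IsFixedPt, Perm.iterate_eq_pow]
  rw [Ne, key, key]
  constructor
  · intro h; rw [h]; decide
  · rintro ⟨h4, h2⟩
    have := Nat.le_of_dvd (by norm_num) h4
    interval_cases classSize (cyc π) x <;> revert h2 h4 <;> decide

lemma pow_apply_ne [Finite X] {π : Perm X} {x : X} {i j : ℕ} (hij : i < j)
    (hj : j < classSize (cyc π) x) : (π ^ i) x ≠ (π ^ j) x := by
  rw [classSize_cyc] at hj
  intro h
  rw [← Perm.iterate_eq_pow, ← Perm.iterate_eq_pow] at h
  exact hij.ne (Function.iterate_injOn_Iio_minimalPeriod (hij.trans hj) hj h)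

end ClassSizes

section Planarity

variable {X : Type*}

lemma cyc_fixed_mul_swap {α : Perm X} {s t : X} (hs : α s = s) (hst : s ≠ t) : ¬ cyc α s t :=
  fun h => hst (fixed_of_cyc hs h)

lemma comp_one (φ : Perm X) : comp φ 1 = cyc φ := by
  rw [comp, cyc_one, sup_bot_eq]

lemma comp_fixed {φ α : Perm X} {x y : X} (h1 : φ x = x) (h2 : α x = x) (h : comp φ α x y) :
    x = y := by
  let t : Setoid X := Setoid.mk (fun y z => y = z ∨ (y ≠ x ∧ z ≠ x))
    { refl := fun _ => Or.inl rfl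
      symm := by rintro a b (rfl | ⟨ha, hb⟩); exacts [Or.inl rfl, Or.inr ⟨hb, ha⟩]
      trans := by
        rintro a b c (rfl | ⟨ha, hb⟩) (rfl | ⟨hb', hc⟩)
        exacts [Or.inl rfl, Or.inr ⟨hb', hc⟩, Or.inr ⟨ha, hb⟩, Or.inr ⟨ha, hc⟩] }
  have aux : ∀ π : Perm X, π x = x → cyc π ≤ t := fun π hπ => cyc_le_iff.2 fun z => by
    by_cases hz : z = x
    · subst hz; exact Or.inl hπ.symm
    · exact Or.inr ⟨hz, fun h => hz (π.injective (h.trans hπ.symm))⟩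
  have : t x y := (sup_le (aux φ h1) (aux α h2) : comp φ α ≤ t) h
  rcases this with h | ⟨h, _⟩
  exacts [h, absurd rfl h]

/-- Equality in the genus inequality: every component is planar. -/
def Planar (φ α : Perm X) : Prop :=
  numClasses (cyc φ) + numClasses (cyc α) + numClasses (cyc (φ * α)) =
    Nat.card X + 2 * numClasses (comp φ α)

variable [DecidableEq X]

lemma mul_swap_comm (φ α : Perm X) (a b : X) :
    φ * swap a b * α = φ * α * swap (α⁻¹ a) (α⁻¹ b) := by
  rw [mul_assoc, mul_assoc, Equiv.mul_swap_eq_swap_mul]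
  simp

lemma mul_swap_mul_mul_swap {α : Perm X} {s t : X} (hs : α s = s) (ht : α t = t) (φ : Perm X) :
    (φ * swap s t) * (α * swap s t) = φ * α := by
  have h : α * swap s t = swap s t * α := by rw [Equiv.mul_swap_eq_swap_mul, hs, ht]
  rw [h, mul_assoc, ← mul_assoc (swap s t), swap_mul_self, one_mul]

variable [Finite X]

lemma cyc_mul_swap_fixed {φ : Perm X} {b s : X} (hs : φ s = s) (hb : b ≠ s) :
    cyc (φ * swap b s) = cyc φ ⊔ cyc (swap b s) :=
  cyc_mul_swap_of_not fun h => hb (fixed_of_cyc hs (SameCycle.symm h)).symm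

lemma comp_insert {φ α : Perm X} {b s : X} (hs : φ s = s) (hb : b ≠ s) :
    comp (φ * swap b s) α = comp φ α ⊔ cyc (swap b s) := by
  unfold comp
  rw [cyc_mul_swap_fixed hs hb, sup_right_comm]

/-- Adding a leg to a map does not change its genus. -/
lemma planar_insert {φ α : Perm X} {b s : X} (hs : φ s = s) (hα : α s = s) (hb : b ≠ s) :
    Planar (φ * swap b s) α ↔ Planar φ α := by
  have hαi : α⁻¹ s = s := by rw [Perm.inv_eq_iff_eq, hα]
  have hb' : α⁻¹ b ≠ s := fun h => hb (by rw [Perm.inv_eq_iff_eq] at h; rw [h, hα])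
  have h1 := numClasses_cyc_mul_swap_of_not (π := φ) (a := b) (b := s)
    fun h => hb (fixed_of_cyc hs (SameCycle.symm h)).symm
  have h2 := numClasses_cyc_mul_swap_of_not (π := φ * α) (a := α⁻¹ b) (b := s)
    fun h => hb' (fixed_of_cyc (by simp [hα, hs]) (SameCycle.symm h)).symm
  have h3 := numClasses_sup_swap (s := comp φ α) (a := b) (b := s)
    fun h => hb (comp_fixed hs hα (Setoid.symm' _ h)).symm
  unfold Planar
  rw [comp_insert hs hb, mul_swap_comm, hαi]
  omega

lemma comp_join {φ α : Perm X} {s t : X} (hs : α s = s) (hst : s ≠ t) :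
    comp (φ * swap s t) (α * swap s t) = comp φ α ⊔ cyc (swap s t) := by
  rw [comp, cyc_mul_swap_of_not (cyc_fixed_mul_swap hs hst), comp]
  refine le_antisymm (sup_le ((cyc_mul_le _ _).trans ?_) ?_) (sup_le (sup_le ?_ ?_) ?_)
  · exact sup_le (le_sup_left.trans le_sup_left) le_sup_right
  · exact sup_le (le_sup_right.trans le_sup_left) le_sup_right
  · conv_lhs => rw [← mul_swap_mul_self s t φ]
    exact (cyc_mul_le _ _).trans (sup_le le_sup_left (le_sup_right.trans le_sup_right))
  · exact le_sup_left.trans le_sup_right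
  · exact le_sup_right.trans le_sup_right

/-- Joining two legs in the same face does not change the genus. -/
lemma planar_join_of_rel {φ α : Perm X} {s t : X} (hs : α s = s) (ht : α t = t) (hst : s ≠ t)
    (h : cyc φ s t) : Planar (φ * swap s t) (α * swap s t) ↔ Planar φ α := by
  have h1 := numClasses_cyc_mul_swap_of_rel hst h
  have h2 := numClasses_cyc_mul_swap_of_not (cyc_fixed_mul_swap hs hst)
  unfold Planar
  rw [comp_join hs hst, mul_swap_mul_mul_swap hs ht,
    sup_swap_eq (s := comp φ α) (sup_left_rel h)]
  omega

/-- Joining two legs in distinct faces gives a planar map only if they lie in distinct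
components. -/
lemma planar_join_of_not {φ α : Perm X} {s t : X} (hs : α s = s) (ht : α t = t) (hst : s ≠ t)
    (h : ¬ cyc φ s t) :
    Planar (φ * swap s t) (α * swap s t) ↔ Planar φ α ∧ ¬ comp φ α s t := by
  have h1 := numClasses_cyc_mul_swap_of_not h
  have h2 := numClasses_cyc_mul_swap_of_not (cyc_fixed_mul_swap hs hst)
  have h3 := genus_le φ α
  unfold Planar
  rw [comp_join hs hst, mul_swap_mul_mul_swap hs ht]
  by_cases hc : comp φ α s t
  · rw [sup_swap_eq hc]
    simp only [hc, not_true, and_false, iff_false]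
    omega
  · have h4 := numClasses_sup_swap hc
    simp only [hc, not_false_eq_true, and_true]
    omega

end Planarity

section Union

variable {X : Type*}

lemma apply_mem_of_out {S : Set X} {π : Perm X} (h : ∀ x ∉ S, π x = x) {x : X} (hx : x ∈ S) :
    π x ∈ S := by
  by_contra hc
  have := π.injective (h _ hc)
  rw [this] at hc
  exact hc hx

lemma comp_trivial_of_out {S : Set X} {φ α : Perm X} (hφ : ∀ x ∉ S, φ x = x)
    (hα : ∀ x ∉ S, α x = x) {x y : X} (h : comp φ α x y) (hxy : x ∉ S ∨ y ∉ S) : x = y := by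
  rcases hxy with hx | hy
  · exact comp_fixed (hφ x hx) (hα x hx) h
  · exact (comp_fixed (hφ y hy) (hα y hy) (Setoid.symm' _ h)).symm

lemma cyc_trivial_of_out {S : Set X} {φ : Perm X} (hφ : ∀ x ∉ S, φ x = x) {x y : X}
    (h : cyc φ x y) (hxy : x ∉ S ∨ y ∉ S) : x = y :=
  comp_trivial_of_out hφ (α := 1) (fun _ _ => rfl) (sup_left_rel h) hxy

variable {S T : Set X} {φ₁ φ₂ α₁ α₂ : Perm X}

lemma cyc_mul_of_disjoint (hST : Disjoint S T) (h₁ : ∀ x ∉ S, φ₁ x = x) (h₂ : ∀ x ∉ T, φ₂ x = x) :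
    cyc (φ₁ * φ₂) = cyc φ₁ ⊔ cyc φ₂ := by
  refine le_antisymm (cyc_mul_le _ _) (sup_le (cyc_le_iff.2 fun x => ?_) (cyc_le_iff.2 fun x => ?_))
  · by_cases hx : x ∈ S
    · have := cyc_apply (φ₁ * φ₂) x
      rwa [Perm.mul_apply, h₂ x (Set.disjoint_left.1 hST hx)] at this
    · rw [h₁ x hx]
  · by_cases hx : x ∈ T
    · have := cyc_apply (φ₁ * φ₂) x
      rwa [Perm.mul_apply, h₁ _ (Set.disjoint_right.1 hST (apply_mem_of_out h₂ hx))] at this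
    · rw [h₂ x hx]

lemma comp_mul_of_disjoint (hST : Disjoint S T) (hφ₁ : ∀ x ∉ S, φ₁ x = x)
    (hφ₂ : ∀ x ∉ T, φ₂ x = x) (hα₁ : ∀ x ∉ S, α₁ x = x) (hα₂ : ∀ x ∉ T, α₂ x = x) :
    comp (φ₁ * φ₂) (α₁ * α₂) = comp φ₁ α₁ ⊔ comp φ₂ α₂ := by
  unfold comp
  rw [cyc_mul_of_disjoint hST hφ₁ hφ₂, cyc_mul_of_disjoint hST hα₁ hα₂, sup_sup_sup_comm]

lemma trivial_or_trivial (hST : Disjoint S T) (hφ₁ : ∀ x ∉ S, φ₁ x = x)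
    (hφ₂ : ∀ x ∉ T, φ₂ x = x) (hα₁ : ∀ x ∉ S, α₁ x = x) (hα₂ : ∀ x ∉ T, α₂ x = x) (x : X) :
    (∀ y, comp φ₁ α₁ x y → x = y) ∨ (∀ y, comp φ₂ α₂ x y → x = y) := by
  by_cases hx : x ∈ S
  · exact Or.inr fun y h => comp_fixed (hφ₂ _ (Set.disjoint_left.1 hST hx))
      (hα₂ _ (Set.disjoint_left.1 hST hx)) h
  · exact Or.inl fun y h => comp_fixed (hφ₁ _ hx) (hα₁ _ hx) h

lemma comp_mul_of_disjoint_rel (hST : Disjoint S T) (hφ₁ : ∀ x ∉ S, φ₁ x = x)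
    (hφ₂ : ∀ x ∉ T, φ₂ x = x) (hα₁ : ∀ x ∉ S, α₁ x = x) (hα₂ : ∀ x ∉ T, α₂ x = x) {x y : X} :
    comp (φ₁ * φ₂) (α₁ * α₂) x y ↔ comp φ₁ α₁ x y ∨ comp φ₂ α₂ x y := by
  rw [comp_mul_of_disjoint hST hφ₁ hφ₂ hα₁ hα₂,
    sup_rel_of_disjoint (trivial_or_trivial hST hφ₁ hφ₂ hα₁ hα₂)]

lemma cyc_mul_of_disjoint_rel (hST : Disjoint S T) (h₁ : ∀ x ∉ S, φ₁ x = x)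
    (h₂ : ∀ x ∉ T, φ₂ x = x) {x y : X} :
    cyc (φ₁ * φ₂) x y ↔ cyc φ₁ x y ∨ cyc φ₂ x y := by
  have := comp_mul_of_disjoint_rel hST h₁ h₂ (α₁ := 1) (α₂ := 1) (fun _ _ => rfl) (fun _ _ => rfl)
    (x := x) (y := y)
  rwa [mul_one, comp_one, comp_one, comp_one] at this

lemma planar_mul_of_disjoint [Finite X] [DecidableEq X] (hST : Disjoint S T)
    (hφ₁ : ∀ x ∉ S, φ₁ x = x)
    (hφ₂ : ∀ x ∉ T, φ₂ x = x) (hα₁ : ∀ x ∉ S, α₁ x = x) (hα₂ : ∀ x ∉ T, α₂ x = x) :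
    Planar (φ₁ * φ₂) (α₁ * α₂) ↔ Planar φ₁ α₁ ∧ Planar φ₂ α₂ := by
  have hσ : φ₁ * φ₂ * (α₁ * α₂) = (φ₁ * α₁) * (φ₂ * α₂) := by
    have : φ₂ * α₁ = α₁ * φ₂ := by
      refine Equiv.ext fun x => ?_
      change φ₂ (α₁ x) = α₁ (φ₂ x)
      by_cases hx : x ∈ S
      · rw [hφ₂ _ (Set.disjoint_left.1 hST hx),
          hφ₂ _ (Set.disjoint_left.1 hST (apply_mem_of_out hα₁ hx))]
      · rw [hα₁ x hx]
        by_cases hx' : x ∈ T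
        · rw [hα₁ _ (Set.disjoint_right.1 hST (apply_mem_of_out hφ₂ hx'))]
        · rw [hφ₂ x hx', hα₁ x hx]
    rw [mul_assoc, ← mul_assoc φ₂, this]
    simp only [mul_assoc]
  have hσ₁ : ∀ x ∉ S, (φ₁ * α₁) x = x := fun x hx => by simp [hα₁ x hx, hφ₁ x hx]
  have hσ₂ : ∀ x ∉ T, (φ₂ * α₂) x = x := fun x hx => by simp [hα₂ x hx, hφ₂ x hx]
  have cycN : ∀ {π₁ π₂ : Perm X}, (∀ x ∉ S, π₁ x = x) → (∀ x ∉ T, π₂ x = x) →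
      numClasses (cyc (π₁ * π₂)) + Nat.card X = numClasses (cyc π₁) + numClasses (cyc π₂) := by
    intro π₁ π₂ h₁ h₂
    have := trivial_or_trivial hST h₁ h₂ (α₁ := 1) (α₂ := 1) (fun _ _ => rfl) (fun _ _ => rfl)
    rw [comp_one, comp_one] at this
    rw [cyc_mul_of_disjoint hST h₁ h₂, numClasses_sup_of_disjoint this]
  have h1 := cycN hφ₁ hφ₂
  have h2 := cycN hα₁ hα₂
  have h3 := cycN hσ₁ hσ₂
  have h4 := numClasses_sup_of_disjoint (trivial_or_trivial hST hφ₁ hφ₂ hα₁ hα₂)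
  rw [← comp_mul_of_disjoint hST hφ₁ hφ₂ hα₁ hα₂] at h4
  have h5 := genus_le φ₁ α₁
  have h6 := genus_le φ₂ α₂
  unfold Planar
  rw [hσ]
  omega

/-- A permutation preserving a set is the product of a permutation supported in the set and one
supported in the complement. -/
lemma exists_mul_of_stable {π : Perm X} (h : ∀ x, π x ∈ S ↔ x ∈ S)
    (hπ : ∀ x, x ∉ S → x ∉ T → π x = x) :
    ∃ π₁ π₂ : Perm X, (∀ x ∉ S, π₁ x = x) ∧ (∀ x ∉ T, π₂ x = x) ∧ π = π₁ * π₂ := by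
  classical
  let π₁ : Perm X := ofSubtype (π.subtypePerm h)
  have h1 : ∀ x ∉ S, π₁ x = x := fun x hx => ofSubtype_apply_of_not_mem _ hx
  have h2 : ∀ x ∈ S, π₁ x = π x := fun x hx => by
    rw [ofSubtype_apply_of_mem _ hx]; rfl
  refine ⟨π₁, π₁⁻¹ * π, h1, fun x hx => ?_, by simp⟩
  rw [Perm.mul_apply, Perm.inv_eq_iff_eq]
  by_cases hxS : x ∈ S
  · rw [h2 x hxS]
  · rw [h1 x hxS, hπ x hxS hx]

end Union

section Maps

variable {X : Type*} [DecidableEq X]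

lemma mul_swap_apply_left (α : Perm X) (s t : X) : (α * swap s t) s = α t := by simp

lemma mul_swap_apply_right (α : Perm X) (s t : X) : (α * swap s t) t = α s := by simp

lemma mul_swap_apply_of_ne (α : Perm X) {s t x : X} (hs : x ≠ s) (ht : x ≠ t) :
    (α * swap s t) x = α x := by
  rw [Perm.mul_apply, swap_apply_of_ne_of_ne hs ht]

lemma involutive_mul_swap_iff {α : Perm X} {s t : X} (hs : α s = s) (ht : α t = t) :
    (∀ x, (α * swap s t) ((α * swap s t) x) = x) ↔ ∀ x, α (α x) = x := by
  have hcomm : swap s t * α = α * swap s t := by rw [Equiv.mul_swap_eq_swap_mul, hs, ht]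
  have : (α * swap s t) * (α * swap s t) = α * α := by
    rw [mul_assoc, ← mul_assoc (swap s t), hcomm, mul_assoc, swap_mul_self, mul_one]
  simp only [← Perm.mul_apply, this]

lemma fixed_mul_swap_iff {S L : Finset X} {α : Perm X} {s t : X} (hsS : s ∈ S) (htS : t ∈ S)
    (hst : s ≠ t) (hs : α s = s) (ht : α t = t) (hsL : s ∉ L) (htL : t ∉ L) :
    (∀ x ∈ S, (α * swap s t) x = x ↔ x ∈ L) ↔
      ∀ x ∈ S, α x = x ↔ x ∈ insert s (insert t L) := by
  refine forall₂_congr fun x hx => ?_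
  by_cases hxs : x = s
  · subst hxs
    simp [ht, hst.symm, hs, hsL]
  by_cases hxt : x = t
  · subst hxt
    simp [ht, hst, hs, htL]
  · rw [mul_swap_apply_of_ne _ hxs hxt]
    simp [hxs, hxt]

lemma out_mul_swap_iff {S : Finset X} {π : Perm X} {s t : X} (hs : s ∈ S) (ht : t ∈ S) :
    (∀ x ∉ S, (π * swap s t) x = x) ↔ ∀ x ∉ S, π x = x := by
  refine forall₂_congr fun x hx => ?_
  rw [mul_swap_apply_of_ne _ (ne_of_mem_of_not_mem hs hx).symm (ne_of_mem_of_not_mem ht hx).symm]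

variable [Finite X]

/-- Connected planar maps with dart set `S`, face permutation `φ` and edge involution `α`; the
darts in `L` are legs, that is, half-edges matched to no other dart. -/
structure IsMap (S L : Finset X) (φ α : Perm X) : Prop where
  φ_out : ∀ x ∉ S, φ x = x
  α_out : ∀ x ∉ S, α x = x
  α_inv : ∀ x, α (α x) = x
  fixed : ∀ x ∈ S, α x = x ↔ x ∈ L
  conn : ∀ x ∈ S, ∀ y ∈ S, comp φ α x y
  planar : Planar φ α

lemma isMap_insert {S L : Finset X} {φ α : Perm X} {b s : X} (hs : s ∉ S) (hb : b ∈ S)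
    (hφs : φ s = s) (hαs : α s = s) :
    IsMap (insert s S) (insert s L) (φ * swap b s) α ↔ IsMap S L φ α := by
  have hbs : b ≠ s := fun h => hs (h ▸ hb)
  constructor
  · intro h
    refine ⟨fun x hx => ?_, fun x hx => ?_, h.α_inv, fun x hx => ?_, fun x hx y hy => ?_,
      (planar_insert hφs hαs hbs).1 h.planar⟩
    · by_cases hxs : x = s
      · rw [hxs, hφs]
      · have := h.φ_out x (by simp [hx, hxs])
        rwa [mul_swap_apply_of_ne _ (ne_of_mem_of_not_mem hb hx).symm hxs] at this
    · by_cases hxs : x = s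
      · rw [hxs, hαs]
      · exact h.α_out x (by simp [hx, hxs])
    · have hxs : x ≠ s := fun h => hs (h ▸ hx)
      simpa [hxs] using h.fixed x (by simp [hx])
    · have := h.conn x (by simp [hx]) y (by simp [hy])
      rw [comp_insert hφs hbs, sup_swap_rel] at this
      rcases this with h | ⟨_, h⟩ | ⟨h, _⟩
      · exact h
      · exact absurd (comp_fixed hφs hαs h) fun h => hs (h ▸ hy)
      · exact absurd (comp_fixed hφs hαs (Setoid.symm' _ h)) fun h => hs (h ▸ hx)
  · intro h
    refine ⟨fun x hx => ?_, fun x hx => ?_, h.α_inv, fun x hx => ?_, ?_,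
      (planar_insert hφs hαs hbs).2 h.planar⟩
    · simp only [Finset.mem_insert, not_or] at hx
      rw [mul_swap_apply_of_ne _ (ne_of_mem_of_not_mem hb hx.2).symm hx.1, h.φ_out x hx.2]
    · simp only [Finset.mem_insert, not_or] at hx
      exact h.α_out x hx.2
    · rcases Finset.mem_insert.1 hx with rfl | hx
      · simp [hαs]
      · have hxs : x ≠ s := fun h => hs (h ▸ hx)
        simpa [hxs] using h.fixed x hx
    · have key : ∀ x ∈ insert s S, comp (φ * swap b s) α b x := by
        intro x hx
        rw [comp_insert hφs hbs]
        rcases Finset.mem_insert.1 hx with rfl | hx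
        · exact sup_right_rel (cyc_swap_rel b x)
        · exact sup_left_rel (h.conn b hb x hx)
      exact fun x hx y hy => Setoid.trans' _ (Setoid.symm' _ (key x hx)) (key y hy)

lemma isMap_join_of_rel {S L : Finset X} {φ α : Perm X} {s t : X} (hsS : s ∈ S) (htS : t ∈ S)
    (hst : s ≠ t) (hs : α s = s) (ht : α t = t) (hsL : s ∉ L) (htL : t ∉ L) (h : cyc φ s t) :
    IsMap S L (φ * swap s t) (α * swap s t) ↔ IsMap S (insert s (insert t L)) φ α := by
  have hc : comp (φ * swap s t) (α * swap s t) = comp φ α := by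
    rw [comp_join hs hst, sup_swap_eq (s := comp φ α) (sup_left_rel h)]
  constructor
  · intro h'
    exact ⟨(out_mul_swap_iff hsS htS).1 h'.φ_out, (out_mul_swap_iff hsS htS).1 h'.α_out,
      (involutive_mul_swap_iff hs ht).1 h'.α_inv,
      (fixed_mul_swap_iff hsS htS hst hs ht hsL htL).1 h'.fixed, hc ▸ h'.conn,
      (planar_join_of_rel hs ht hst h).1 h'.planar⟩
  · intro h'
    exact ⟨(out_mul_swap_iff hsS htS).2 h'.φ_out, (out_mul_swap_iff hsS htS).2 h'.α_out,
      (involutive_mul_swap_iff hs ht).2 h'.α_inv,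
      (fixed_mul_swap_iff hsS htS hst hs ht hsL htL).2 h'.fixed, hc ▸ h'.conn,
      (planar_join_of_rel hs ht hst h).2 h'.planar⟩

/-- The two sides of a bridge are planar maps. -/
lemma isMap_bridge {S T : Finset X} {φ₁ φ₂ α₁ α₂ : Perm X} {r s t : X} (hST : Disjoint S T)
    (hsS : s ∉ S) (hsT : s ∉ T) (hr : r ∈ S) (ht : t ∈ T)
    (hφ₁ : ∀ x ∉ S, φ₁ x = x) (hφ₂ : ∀ x ∉ T, φ₂ x = x) (hα₁ : ∀ x ∉ S, α₁ x = x)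
    (hα₂ : ∀ x ∉ T, α₂ x = x) (hαt : α₂ t = t) :
    IsMap (insert s (S ∪ T)) {r} (φ₁ * φ₂ * swap r s * swap s t) (α₁ * α₂ * swap s t) ↔
      IsMap S {r} φ₁ α₁ ∧ IsMap T {t} φ₂ α₂ := by
  have hST' : Disjoint (S : Set X) T := Finset.disjoint_coe.2 hST
  have hφS : ∀ x ∈ S, (φ₁ * φ₂) x = φ₁ x := fun x hx => by
    rw [Perm.mul_apply, hφ₂ _ (Finset.disjoint_left.1 hST hx)]
  have hαS : ∀ x ∈ S, (α₁ * α₂) x = α₁ x := fun x hx => by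
    rw [Perm.mul_apply, hα₂ _ (Finset.disjoint_left.1 hST hx)]
  have hαT : ∀ x ∈ T, (α₁ * α₂) x = α₂ x := fun x hx => by
    rw [Perm.mul_apply, hα₁ _ (Finset.disjoint_right.1 hST
      (apply_mem_of_out (S := (T : Set X)) hα₂ hx))]
  have hφs : (φ₁ * φ₂) s = s := by rw [Perm.mul_apply, hφ₂ s hsT, hφ₁ s hsS]
  have hαs : (α₁ * α₂) s = s := by rw [Perm.mul_apply, hα₂ s hsT, hα₁ s hsS]
  have hαt' : (α₁ * α₂) t = t := by rw [hαT t ht, hαt]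
  have hrs : r ≠ s := fun h => hsS (h ▸ hr)
  have hst : s ≠ t := fun h => hsT (h ▸ ht)
  have hrT : r ∉ T := Finset.disjoint_left.1 hST hr
  have htS : t ∉ S := Finset.disjoint_right.1 hST ht
  have hrel {x y : X} := comp_mul_of_disjoint_rel hST' hφ₁ hφ₂ hα₁ hα₂ (x := x) (y := y)
  have c1 {x y : X} (h : comp φ₁ α₁ x y) (h' : x ∉ S ∨ y ∉ S) : x = y :=
    comp_trivial_of_out (S := (S : Set X)) hφ₁ hα₁ h h'
  have c2 {x y : X} (h : comp φ₂ α₂ x y) (h' : x ∉ T ∨ y ∉ T) : x = y :=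
    comp_trivial_of_out (S := (T : Set X)) hφ₂ hα₂ h h'
  have hnc : ¬ comp (φ₁ * φ₂ * swap r s) (α₁ * α₂) s t := by
    rw [comp_insert hφs hrs, sup_swap_rel, hrel, hrel, hrel, hrel]
    rintro ((h | h) | ⟨h | h, _⟩ | ⟨_, h | h⟩)
    · exact hst (c1 h (Or.inl hsS))
    · exact hst (c2 h (Or.inl hsT))
    · exact hrs (c1 h (Or.inl hsS)).symm
    · exact hrs (c2 h (Or.inl hsT)).symm
    · exact hrT ((c1 h (Or.inr htS)) ▸ ht)
    · exact hrT ((c2 h (Or.inl hrT)) ▸ ht)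
  have hcyc : ¬ cyc (φ₁ * φ₂ * swap r s) s t := fun h => hnc (sup_left_rel h)
  have hplanar : Planar (φ₁ * φ₂ * swap r s * swap s t) (α₁ * α₂ * swap s t) ↔
      Planar φ₁ α₁ ∧ Planar φ₂ α₂ := by
    rw [planar_join_of_not hαs hαt' hst hcyc, planar_insert hφs hαs hrs,
      planar_mul_of_disjoint hST' hφ₁ hφ₂ hα₁ hα₂]
    simp [hnc]
  have hcomp : comp (φ₁ * φ₂ * swap r s * swap s t) (α₁ * α₂ * swap s t) =
      comp (φ₁ * φ₂) (α₁ * α₂) ⊔ cyc (swap r s) ⊔ cyc (swap s t) := by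
    rw [comp_join hαs hst, comp_insert hφs hrs]
  have hconn : (∀ x ∈ insert s (S ∪ T), ∀ y ∈ insert s (S ∪ T),
      comp (φ₁ * φ₂ * swap r s * swap s t) (α₁ * α₂ * swap s t) x y) ↔
      (∀ x ∈ S, ∀ y ∈ S, comp φ₁ α₁ x y) ∧ (∀ x ∈ T, ∀ y ∈ T, comp φ₂ α₂ x y) := by
    rw [hcomp]
    constructor
    · intro h
      have hS : comp (φ₁ * φ₂) (α₁ * α₂) ⊔ cyc (swap r s) ⊔ cyc (swap s t) ≤
          Setoid.comap (fun x => if x ∈ S then x else r) (comp φ₁ α₁) := by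
        refine sup_le (sup_le (fun x y hxy => ?_) (cyc_swap_le_iff.2 ?_)) (cyc_swap_le_iff.2 ?_)
        · rw [Setoid.comap_rel]
          rcases hrel.1 hxy with h | h
          · by_cases hx : x ∈ S
            · by_cases hy : y ∈ S
              · simpa [hx, hy] using h
              · rw [c1 h (Or.inr hy)]
            · rw [c1 h (Or.inl hx)]
          · by_cases hx : x ∈ T
            · by_cases hy : y ∈ T
              · simp [Finset.disjoint_right.1 hST hx, Finset.disjoint_right.1 hST hy]
              · rw [c2 h (Or.inr hy)]
            · rw [c2 h (Or.inl hx)]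
        · simp [Setoid.comap_rel, hr, hsS]
        · simp [Setoid.comap_rel, hsS, htS]
      have hT : comp (φ₁ * φ₂) (α₁ * α₂) ⊔ cyc (swap r s) ⊔ cyc (swap s t) ≤
          Setoid.comap (fun x => if x ∈ T then x else t) (comp φ₂ α₂) := by
        refine sup_le (sup_le (fun x y hxy => ?_) (cyc_swap_le_iff.2 ?_)) (cyc_swap_le_iff.2 ?_)
        · rw [Setoid.comap_rel]
          rcases hrel.1 hxy with h | h
          · by_cases hx : x ∈ S
            · by_cases hy : y ∈ S
              · simp [Finset.disjoint_left.1 hST hx, Finset.disjoint_left.1 hST hy]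
              · rw [c1 h (Or.inr hy)]
            · rw [c1 h (Or.inl hx)]
          · by_cases hx : x ∈ T
            · by_cases hy : y ∈ T
              · simpa [hx, hy] using h
              · rw [c2 h (Or.inr hy)]
            · rw [c2 h (Or.inl hx)]
        · simp [Setoid.comap_rel, hrT, hsT]
        · simp [Setoid.comap_rel, hsT, ht]
      constructor
      · intro x hx y hy
        have := hS (h x (by simp [hx]) y (by simp [hy]))
        simpa [Setoid.comap_rel, hx, hy] using this
      · intro x hx y hy
        have := hT (h x (by simp [hx]) y (by simp [hy]))
        simpa [Setoid.comap_rel, hx, hy] using this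
    · rintro ⟨h1, h2⟩
      set u := comp (φ₁ * φ₂) (α₁ * α₂) ⊔ cyc (swap r s) ⊔ cyc (swap s t)
      have hrs' : u r s := sup_left_rel (sup_right_rel (cyc_swap_rel r s))
      have hst' : u s t := sup_right_rel (cyc_swap_rel s t)
      have key : ∀ x ∈ insert s (S ∪ T), u s x := by
        intro x hx
        simp only [Finset.mem_insert, Finset.mem_union] at hx
        rcases hx with rfl | hx | hx
        · exact u.refl x
        · exact u.trans (u.symm hrs') (sup_left_rel (sup_left_rel (hrel.2 (Or.inl (h1 r hr x hx)))))
        · exact u.trans hst' (sup_left_rel (sup_left_rel (hrel.2 (Or.inr (h2 t ht x hx)))))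
      exact fun x hx y hy => u.trans (u.symm (key x hx)) (key y hy)
  have hsU : s ∈ insert s (S ∪ T) := by simp
  have htU : t ∈ insert s (S ∪ T) := by simp [ht]
  have hrU : r ∈ insert s (S ∪ T) := by simp [hr]
  have hinv : (∀ x, (α₁ * α₂) ((α₁ * α₂) x) = x) ↔
      (∀ x, α₁ (α₁ x) = x) ∧ (∀ x, α₂ (α₂ x) = x) := by
    constructor
    · intro h
      constructor
      · intro x
        by_cases hx : x ∈ S
        · have := h x
          rwa [hαS x hx, hαS _ (apply_mem_of_out (S := (S : Set X)) hα₁ hx)] at this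
        · rw [hα₁ x hx, hα₁ x hx]
      · intro x
        by_cases hx : x ∈ T
        · have := h x
          rwa [hαT x hx, hαT _ (apply_mem_of_out (S := (T : Set X)) hα₂ hx)] at this
        · rw [hα₂ x hx, hα₂ x hx]
    · rintro ⟨h1, h2⟩ x
      by_cases hx : x ∈ S
      · rw [hαS x hx, hαS _ (apply_mem_of_out (S := (S : Set X)) hα₁ hx), h1]
      by_cases hx' : x ∈ T
      · rw [hαT x hx', hαT _ (apply_mem_of_out (S := (T : Set X)) hα₂ hx'), h2]
      · simp [hα₁ x hx, hα₂ x hx']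
  have hfix := fixed_mul_swap_iff (L := {r}) (α := α₁ * α₂) hsU htU hst hαs hαt'
    (by simpa using hrs.symm) (by simpa using fun h : t = r => htS (h ▸ hr))
  constructor
  · intro h
    have hf := hfix.1 h.fixed
    have hc := hconn.1 h.conn
    have hp := hplanar.1 h.planar
    have hi := hinv.1 ((involutive_mul_swap_iff hαs hαt').1 h.α_inv)
    refine ⟨⟨hφ₁, hα₁, hi.1, fun x hx => ?_, hc.1, hp.1⟩,
      ⟨hφ₂, hα₂, hi.2, fun x hx => ?_, hc.2, hp.2⟩⟩
    · rw [← hαS x hx, hf x (by simp [hx])]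
      have : x ≠ s := fun h => hsS (h ▸ hx)
      have : x ≠ t := fun h => htS (h ▸ hx)
      simp [*]
    · rw [← hαT x hx, hf x (by simp [hx])]
      have : x ≠ s := fun h => hsT (h ▸ hx)
      have : x ≠ r := fun h => hrT (h ▸ hx)
      simp [*]
  · rintro ⟨h1, h2⟩
    refine ⟨?_, ?_, (involutive_mul_swap_iff hαs hαt').2 (hinv.2 ⟨h1.α_inv, h2.α_inv⟩),
      hfix.2 ?_, hconn.2 ⟨h1.conn, h2.conn⟩, hplanar.2 ⟨h1.planar, h2.planar⟩⟩
    · refine (out_mul_swap_iff hsU htU).2 ((out_mul_swap_iff hrU hsU).2 fun x hx => ?_)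
      simp only [Finset.mem_insert, Finset.mem_union, not_or] at hx
      simp [hφ₁ x hx.2.1, hφ₂ x hx.2.2]
    · refine (out_mul_swap_iff hsU htU).2 fun x hx => ?_
      simp only [Finset.mem_insert, Finset.mem_union, not_or] at hx
      simp [hα₁ x hx.2.1, hα₂ x hx.2.2]
    · intro x hx
      simp only [Finset.mem_insert, Finset.mem_union] at hx
      rcases hx with rfl | hx | hx
      · simp [hα₁ x hsS, hα₂ x hsT]
      · rw [hαS x hx, h1.fixed x hx]
        have : x ≠ s := fun h => hsS (h ▸ hx)
        have : x ≠ t := fun h => htS (h ▸ hx)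
        simp [*]
      · rw [hαT x hx, h2.fixed x hx]
        have : x ≠ s := fun h => hsT (h ▸ hx)
        have : x ≠ r := fun h => hrT (h ▸ hx)
        simp [*]

end Maps

section Quad

variable {X : Type*}

lemma sup_swap_fixed_rel [DecidableEq X] {t : Setoid X} {r s x y : X} (hs : ∀ z, t z s → z = s)
    (hx : x ≠ s) (hy : y ≠ s) : (t ⊔ cyc (swap r s)) x y ↔ t x y := by
  rw [sup_swap_rel]
  constructor
  · rintro (h | ⟨_, h⟩ | ⟨h, _⟩)
    exacts [h, absurd (hs y (t.symm h)) hy, absurd (hs x h) hx]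
  · exact Or.inl

/-- Quadrangulations with a boundary on the dart set `S`: planar maps with a single leg `r`, lying
in a face of degree `2 * p + 1`, such that all other faces have degree four. -/
structure IsQ (S : Finset X) (r : X) (p : ℕ) (φ α : Perm X) : Prop where
  map : IsMap S {r} φ α
  mem : r ∈ S
  root : classSize (cyc φ) r = 2 * p + 1
  quad : ∀ x ∈ S, ¬ cyc φ r x → classSize (cyc φ) x = 4

lemma IsMap.cyc_mem {S L : Finset X} {φ α : Perm X} (h : IsMap S L φ α) {x y : X}
    (hxy : cyc φ x y) (hx : x ∈ S) : y ∈ S := by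
  classical
  by_contra hy
  exact hy (cyc_trivial_of_out (S := (S : Set X)) h.φ_out hxy (Or.inr hy) ▸ hx)

lemma cyc_pow_apply (π : Perm X) (k : ℕ) (x : X) : cyc π x ((π ^ k) x) := ⟨k, by simp⟩

lemma IsQ.apply_leg {S : Finset X} {r : X} {p : ℕ} {φ α : Perm X} (h : IsQ S r p φ α) :
    α r = r := (h.map.fixed r h.mem).2 (by simp)

lemma IsQ.apply_root [Finite X] {S : Finset X} {r s t : X} {p : ℕ} {φ α : Perm X} (h : IsQ S r (p + 1) φ α)
    (hs : φ r = s) (ht : α s = t) :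
    s ∈ S ∧ t ∈ S ∧ r ≠ s ∧ r ≠ t ∧ s ≠ t := by
  have hsS : s ∈ S := h.map.cyc_mem (by simpa [hs] using cyc_apply φ r) h.mem
  have htS : t ∈ S := by
    have := apply_mem_of_out (S := (S : Set X)) h.map.α_out hsS
    rwa [ht] at this
  have hrs : r ≠ s := by
    have := pow_apply_ne (π := φ) (x := r) (i := 0) (j := 1) (by norm_num) (by rw [h.root]; omega)
    rwa [pow_one, hs] at this
  have hst : s ≠ t := by
    intro hc
    have := (h.map.fixed s hsS).1 (ht.trans hc.symm)
    exact hrs (by simpa using this : s = r).symm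
  refine ⟨hsS, htS, hrs, ?_, hst⟩
  rintro rfl
  have := h.map.α_inv s
  rw [ht, h.apply_leg] at this
  exact hrs this

variable [DecidableEq X] [Finite X]

lemma odd_root_degree {S : Finset X} {r : X} {φ α : Perm X} (h : IsMap S {r} φ α) (hr : r ∈ S)
    (hq : ∀ x ∈ S, ¬ cyc φ r x → classSize (cyc φ) x = 4) : Odd (classSize (cyc φ) r) := by
  classical
  have two : (1 : ZMod 2) + 1 = 0 := by decide
  have h1 : ((S.erase r).card : ZMod 2) = 0 := by
    rw [Finset.card_eq_sum_ones, Nat.cast_sum]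
    refine Finset.sum_involution (fun x _ => α x) (fun _ _ => by simpa using two)
      (fun x hx _ => ?_) (fun x hx => ?_) (fun x _ => h.α_inv x)
    · rw [Finset.mem_erase] at hx
      rw [Ne, h.fixed x hx.2]
      simpa using hx.1
    · rw [Finset.mem_erase] at hx ⊢
      refine ⟨fun hc => hx.1 ?_, apply_mem_of_out (S := (S : Set X)) h.α_out hx.2⟩
      rw [← h.α_inv x, hc, (h.fixed r hr).2 (by simp)]
  have h2 : ((S.filter fun x => ¬ cyc φ r x).card : ZMod 2) = 0 := by
    rw [Finset.card_eq_sum_ones, Nat.cast_sum]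
    have key : ∀ x ∈ S.filter fun x => ¬ cyc φ r x, (φ ^ 4) x = x ∧ (φ ^ 2) x ≠ x := by
      intro x hx
      rw [Finset.mem_filter] at hx
      exact classSize_cyc_eq_four_iff.1 (hq x hx.1 hx.2)
    refine Finset.sum_involution (fun x _ => (φ ^ 2) x) (fun _ _ => by simpa using two)
      (fun x hx _ => (key x hx).2) (fun x hx => ?_) (fun x hx => ?_)
    · rw [Finset.mem_filter] at hx ⊢
      exact ⟨h.cyc_mem (cyc_pow_apply φ 2 x) hx.1,
        fun hc => hx.2 (Setoid.trans' _ hc (Setoid.symm' _ (cyc_pow_apply φ 2 x)))⟩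
    · rw [← Perm.mul_apply, ← pow_add]
      exact (key x hx).1
  have h3 : (S.filter fun x => cyc φ r x).card = classSize (cyc φ) r := by
    rw [classSize, ← Nat.card_eq_finsetCard]
    refine Nat.card_congr (Equiv.subtypeEquivRight fun x => ?_)
    rw [Finset.mem_filter]
    exact ⟨And.right, fun h' => ⟨h.cyc_mem h' hr, h'⟩⟩
  have h4 := Finset.card_filter_add_card_filter_not (s := S) (fun x => cyc φ r x)
  have h5 := Finset.card_erase_add_one hr
  rw [ZMod.natCast_eq_zero_iff_even] at h1 h2
  rw [← h3, ← Nat.not_even_iff_odd]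
  intro h6
  rw [← h4] at h5
  have h7 := h6.add h2
  rw [← h5] at h7
  exact (Nat.not_even_iff_odd.2 h1.add_one) h7

section Glue

variable {S : Finset X} {φ α : Perm X} {r b s t : X}

/-- Removing the root edge when its two sides lie in different faces. -/
lemma glue_aux (hs : s ∉ S) (ht : t ∉ S) (hst : s ≠ t) (hr : r ∈ S) (hb : b ∈ S)
    (hφ : ∀ x ∉ S, φ x = x) (hα : ∀ x ∉ S, α x = x) (hrb : cyc φ r b) (ψ : Perm X)
    (hψ : ψ = φ * swap b t * swap r s * swap s t) :
    (IsMap (insert s (insert t S)) {r} ψ (α * swap s t) ↔ IsMap S {r} φ α) ∧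
    ψ r = s ∧ ¬ cyc ψ r t ∧
    classSize (cyc ψ) r + classSize (cyc ψ) t = classSize (cyc φ) r + 2 ∧
    ∀ x ∈ S, (cyc φ r x ↔ cyc ψ r x ∨ cyc ψ t x) ∧
      (¬ cyc φ r x → classSize (cyc ψ) x = classSize (cyc φ) x) := by
  have hrs : r ≠ s := ne_of_mem_of_not_mem hr hs
  have hrt : r ≠ t := ne_of_mem_of_not_mem hr ht
  have hbs : b ≠ s := ne_of_mem_of_not_mem hb hs
  have hbt : b ≠ t := ne_of_mem_of_not_mem hb ht
  have hs' : (φ * swap b t) s = s := by rw [mul_swap_apply_of_ne _ hbs.symm hst, hφ s hs]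
  set χ := φ * swap b t * swap r s with hχ
  have hcχ : cyc χ = cyc φ ⊔ cyc (swap b t) ⊔ cyc (swap r s) := by
    rw [hχ, cyc_mul_swap_fixed hs' hrs, cyc_mul_swap_fixed (hφ t ht) hbt]
  have triv1 : ∀ z, cyc φ z t → z = t := fun z h => (fixed_of_cyc (hφ t ht) (Setoid.symm' _ h)).symm
  have triv2 : ∀ z, (cyc φ ⊔ cyc (swap b t)) z s → z = s := fun z h => by
    rw [← cyc_mul_swap_fixed (hφ t ht) hbt] at h
    exact (fixed_of_cyc hs' (Setoid.symm' _ h)).symm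
  have hcχS : ∀ x ∈ S, ∀ y ∈ S, cyc χ x y ↔ cyc φ x y := by
    intro x hx y hy
    rw [hcχ, sup_swap_fixed_rel triv2 (ne_of_mem_of_not_mem hx hs) (ne_of_mem_of_not_mem hy hs),
      sup_swap_fixed_rel triv1 (ne_of_mem_of_not_mem hx ht) (ne_of_mem_of_not_mem hy ht)]
  have hχrs : cyc χ r s := by rw [hcχ]; exact sup_right_rel (cyc_swap_rel r s)
  have hχrt : cyc χ r t := by
    refine Setoid.trans' _ ((hcχS r hr b hb).2 hrb) ?_
    rw [hcχ]; exact sup_left_rel (sup_right_rel (cyc_swap_rel b t))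
  have hχst : cyc χ s t := Setoid.trans' _ (Setoid.symm' _ hχrs) hχrt
  have hψst : ¬ cyc ψ s t := by rw [hψ]; exact not_cyc_mul_swap hst hχst
  have hχψ : cyc χ = cyc ψ ⊔ cyc (swap s t) := by rw [hψ]; exact cyc_eq_sup_of_rel hst hχst
  have hψr : ψ r = s := by
    rw [hψ, mul_swap_apply_of_ne _ hrs hrt, hχ, mul_swap_apply_left, hs']
  have hψrs : cyc ψ r s := by simpa [hψr] using cyc_apply ψ r
  have hψrt : ¬ cyc ψ r t := fun h => hψst (Setoid.trans' _ (Setoid.symm' _ hψrs) h)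
  have iff1 : ∀ x, cyc χ r x ↔ cyc ψ r x ∨ cyc ψ t x := by
    intro x
    rw [hχψ, sup_swap_rel]
    simp [hψrs, hψrt]
  refine ⟨?_, hψr, hψrt, ?_, fun x hx => ⟨by rw [← hcχS r hr x hx, iff1], fun h => ?_⟩⟩
  · rw [hψ, isMap_join_of_rel (by simp) (by simp) hst (hα s hs) (hα t ht) (by simpa using hrs.symm)
      (by simpa using hrt.symm) hχst, hχ, isMap_insert (by simp [hs, hst]) (by simp [hr]) hs'
      (hα s hs), isMap_insert ht hb (hφ t ht) (hα t ht)]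
  · have e1 : classSize (cyc χ) s = classSize (cyc ψ) s + classSize (cyc ψ) t := by
      rw [hχψ, classSize_sup_swap hψst]
    have e2 : classSize (cyc χ) r = classSize (cyc φ ⊔ cyc (swap b t)) r + 1 := by
      rw [hcχ, classSize_sup_swap fun h => hrs (triv2 _ h),
        classSize_eq_one (x := s) fun y h => (triv2 y (Setoid.symm' _ h)).symm]
    have e3 : classSize (cyc φ ⊔ cyc (swap b t)) b = classSize (cyc φ) b + 1 := by
      rw [classSize_sup_swap fun h => hbt (triv1 _ h),
        classSize_eq_one (x := t) fun y h => (triv1 y (Setoid.symm' _ h)).symm]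
    rw [classSize_eq_of_rel hψrs, ← e1, ← classSize_eq_of_rel hχrs, e2,
      classSize_eq_of_rel (sup_left_rel hrb), e3, classSize_eq_of_rel hrb]
  · have hχx : ¬ cyc χ r x := by rwa [hcχS r hr x hx]
    have n1 : ¬ cyc χ x s := fun h => hχx (Setoid.trans' _ hχrs (Setoid.symm' _ h))
    have n2 : ¬ cyc χ x t := fun h => hχx (Setoid.trans' _ hχrt (Setoid.symm' _ h))
    have e1 : classSize (cyc χ) x = classSize (cyc ψ) x := by
      refine classSize_congr fun z => ?_
      rw [hχψ, sup_swap_rel_of_not]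
      · exact fun h => n1 (by rw [hχψ]; exact sup_left_rel h)
      · exact fun h => n2 (by rw [hχψ]; exact sup_left_rel h)
    rw [← e1]
    refine classSize_congr fun z => ?_
    by_cases hz : z ∈ S
    · exact hcχS x hx z hz
    · constructor
      · intro h
        exfalso
        rw [hcχ, sup_swap_rel_of_not, sup_swap_rel_of_not] at h
        · exact hz (cyc_trivial_of_out (S := (S : Set X)) hφ h (Or.inr hz) ▸ hx)
        · exact fun h' => hχx (Setoid.symm' _
            (by rw [hcχ]; exact sup_left_rel (sup_left_rel (Setoid.trans' _ h' (Setoid.symm' _ hrb)))))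
        · exact fun h' => ne_of_mem_of_not_mem hx ht (triv1 _ h')
        · exact fun h' => hχx (Setoid.symm' _ (by rw [hcχ]; exact sup_left_rel h'))
        · exact fun h' => ne_of_mem_of_not_mem hx hs (triv2 _ h')
      · intro h
        exact absurd (cyc_trivial_of_out (S := (S : Set X)) hφ h (Or.inr hz) ▸ hx) hz

lemma glue_forward {p : ℕ} (h : IsQ S r (p + 2) φ α) (hs : s ∉ S) (ht : t ∉ S) (hst : s ≠ t)
    (ψ : Perm X) (hψ : ψ = φ * swap ((φ ^ 3) r) t * swap r s * swap s t) :
    IsQ (insert s (insert t S)) r (p + 1) ψ (α * swap s t) ∧ ψ r = s ∧ (α * swap s t) s = t ∧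
      ¬ cyc ψ r t ∧ (ψ ^ 3) t = (φ ^ 3) r := by
  have hr := h.mem
  have hpow : ∀ k, (φ ^ k) r ∈ S := fun k => h.map.cyc_mem (cyc_pow_apply φ k r) hr
  have hne : ∀ i j, i < j → j < 5 → (φ ^ i) r ≠ (φ ^ j) r := fun i j hij hj =>
    pow_apply_ne hij (by rw [h.root]; omega)
  obtain ⟨h1, h2, h3, h4, h5⟩ := glue_aux hs ht hst hr (hpow 3) h.map.φ_out h.map.α_out
    (cyc_pow_apply φ 3 r) ψ hψ
  have nes : ∀ k, (φ ^ k) r ≠ s := fun k => ne_of_mem_of_not_mem (hpow k) hs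
  have net : ∀ k, (φ ^ k) r ≠ t := fun k => ne_of_mem_of_not_mem (hpow k) ht
  have hrs : r ≠ s := nes 0
  have hrt : r ≠ t := net 0
  have hrb : r ≠ (φ ^ 3) r := hne 0 3 (by norm_num) (by norm_num)
  have t1 : ψ t = (φ ^ 1) r := by
    rw [hψ, mul_swap_apply_right, mul_swap_apply_right, mul_swap_apply_of_ne _ hrb hrt, pow_one]
  have t2 : ∀ k, k ≠ 0 → k < 3 → ψ ((φ ^ k) r) = (φ ^ (k + 1)) r := by
    intro k hk hk'
    rw [hψ, mul_swap_apply_of_ne _ (nes k) (net k),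
      mul_swap_apply_of_ne _ (x := (φ ^ k) r) (s := r) (hne 0 k (by omega) (by omega)).symm (nes k),
      mul_swap_apply_of_ne _ (hne k 3 (by omega) (by omega)) (net k), pow_succ', Perm.mul_apply]
  have t3 : ψ ((φ ^ 3) r) = t := by
    rw [hψ, mul_swap_apply_of_ne _ (nes 3) (net 3), mul_swap_apply_of_ne _ hrb.symm (nes 3),
      mul_swap_apply_left, h.map.φ_out t ht]
  have p2 : (ψ ^ 2) t = (φ ^ 2) r := by
    rw [pow_succ', pow_one, Perm.mul_apply, t1, t2 1 (by norm_num) (by norm_num)]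
  have p3 : (ψ ^ 3) t = (φ ^ 3) r := by
    rw [pow_succ', Perm.mul_apply, p2, t2 2 (by norm_num) (by norm_num)]
  have p4 : (ψ ^ 4) t = t := by rw [pow_succ', Perm.mul_apply, p3, t3]
  have c4 : classSize (cyc ψ) t = 4 := by
    rw [classSize_cyc_eq_four_iff, p4, p2]
    exact ⟨rfl, net 2⟩
  refine ⟨⟨h1.2 h.map, by simp [hr], ?_, fun x hx hx' => ?_⟩, h2, ?_, h3, p3⟩
  · have := h.root; omega
  · simp only [Finset.mem_insert] at hx
    rcases hx with rfl | rfl | hx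
    · exact absurd (by simpa [h2] using cyc_apply ψ r) hx'
    · exact c4
    · by_cases hc : cyc φ r x
      · rcases ((h5 x hx).1.1 hc) with h' | h'
        · exact absurd h' hx'
        · rw [← classSize_eq_of_rel h', c4]
      · rw [(h5 x hx).2 hc, h.quad x hx hc]
  · rw [mul_swap_apply_left, h.map.α_out t ht]

lemma glue_backward {p : ℕ} (h : IsQ S r (p + 1) φ α) (hs : φ r = s) (ht : α s = t)
    (hrt' : ¬ cyc φ r t) (ψ : Perm X)
    (hψ : ψ = φ * swap s t * swap r s * swap ((φ ^ 3) t) t) :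
    IsQ (S \ {s, t}) r (p + 2) ψ (α * swap s t) ∧ (ψ ^ 3) r = (φ ^ 3) t := by
  obtain ⟨hsS, htS, hrs, hrt, hst⟩ := h.apply_root hs ht
  have c4 := h.quad t htS hrt'
  have hcrs : cyc φ r s := by simpa [hs] using cyc_apply φ r
  have hpow : ∀ k, (φ ^ k) t ∈ S := fun k => h.map.cyc_mem (cyc_pow_apply φ k t) htS
  have ner : ∀ k, (φ ^ k) t ≠ r := fun k hc =>
    hrt' (Setoid.symm' _ (by simpa only [hc] using cyc_pow_apply φ k t))
  have nes : ∀ k, (φ ^ k) t ≠ s := fun k hc =>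
    hrt' (Setoid.trans' _ hcrs (Setoid.symm' _ (by simpa only [hc] using cyc_pow_apply φ k t)))
  have hne : ∀ i j, i < j → j < 4 → (φ ^ i) t ≠ (φ ^ j) t := fun i j hij hj =>
    pow_apply_ne hij (by omega)
  have p4 := (classSize_cyc_eq_four_iff.1 c4).1
  have hbt : (φ ^ 3) t ≠ t := (hne 0 3 (by norm_num) (by norm_num)).symm
  have φb : φ ((φ ^ 3) t) = t := by rw [← Perm.mul_apply, ← pow_succ', p4]
  set b := (φ ^ 3) t with hb
  have hφ : φ = ψ * swap b t * swap r s * swap s t := by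
    rw [hψ]; simp only [mul_swap_mul_self]
  have fs : ψ s = s := by
    rw [hψ, mul_swap_apply_of_ne _ (nes 3).symm hst, mul_swap_apply_right,
      mul_swap_apply_of_ne _ hrs hrt, hs]
  have ft : ψ t = t := by
    rw [hψ, mul_swap_apply_right, mul_swap_apply_of_ne _ (ner 3) (nes 3),
      mul_swap_apply_of_ne _ (nes 3) hbt, φb]
  have r1 : (ψ ^ 1) r = (φ ^ 1) t := by
    rw [pow_one, hψ, mul_swap_apply_of_ne _ (ner 3).symm hrt, mul_swap_apply_left,
      mul_swap_apply_left, pow_one]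
  have st : ∀ k, k ≠ 0 → k < 3 → ψ ((φ ^ k) t) = (φ ^ (k + 1)) t := by
    intro k hk hk'
    have : (φ ^ k) t ≠ t := (hne 0 k (by omega) (by omega)).symm
    rw [hψ, mul_swap_apply_of_ne _ (hne k 3 (by omega) (by omega)) this,
      mul_swap_apply_of_ne _ (ner k) (nes k), mul_swap_apply_of_ne _ (nes k) this, pow_succ',
      Perm.mul_apply]
  have r3 : (ψ ^ 3) r = b := by
    rw [pow_succ', Perm.mul_apply, pow_succ', Perm.mul_apply, r1, st 1 (by norm_num) (by norm_num),
      st 2 (by norm_num) (by norm_num)]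
  have hS : insert s (insert t (S \ {s, t})) = S := by
    ext x
    simp only [Finset.mem_insert, Finset.mem_sdiff, Finset.mem_singleton]
    constructor
    · rintro (rfl | rfl | h)
      exacts [hsS, htS, h.1]
    · intro hx
      tauto
  have hα : α = α * swap s t * swap s t := by rw [mul_swap_mul_self]
  have hts : α t = s := by rw [← ht, h.map.α_inv]
  have as : (α * swap s t) s = s := by rw [mul_swap_apply_left, hts]
  have at' : (α * swap s t) t = t := by rw [mul_swap_apply_right, ht]
  have hψout : ∀ x ∉ S \ {s, t}, ψ x = x := by
    intro x hx
    by_cases hxs : x = s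
    · rw [hxs, fs]
    by_cases hxt : x = t
    · rw [hxt, ft]
    have hxS : x ∉ S := fun h' => hx (by simp [h', hxs, hxt])
    have hx1 := ne_of_mem_of_not_mem (hpow 3) hxS
    rw [hψ, mul_swap_apply_of_ne _ hx1.symm hxt,
      mul_swap_apply_of_ne _ (ne_of_mem_of_not_mem h.mem hxS).symm hxs,
      mul_swap_apply_of_ne _ hxs hxt, h.map.φ_out x hxS]
  have hαout : ∀ x ∉ S \ {s, t}, (α * swap s t) x = x := by
    intro x hx
    by_cases hxs : x = s
    · rw [hxs, as]
    by_cases hxt : x = t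
    · rw [hxt, at']
    have hxS : x ∉ S := fun h' => hx (by simp [h', hxs, hxt])
    rw [mul_swap_apply_of_ne _ hxs hxt, h.map.α_out x hxS]
  have hrS : r ∈ S \ {s, t} := by simp [h.mem, hrs, hrt]
  have hbS : b ∈ S \ {s, t} := by
    simp only [Finset.mem_sdiff, Finset.mem_insert, Finset.mem_singleton, not_or]
    exact ⟨hpow 3, nes 3, hbt⟩
  obtain ⟨h1, -, -, h4, h5⟩ := glue_aux (s := s) (t := t) (by simp) (by simp) hst hrS hbS
    hψout hαout (by rw [← r3]; exact cyc_pow_apply ψ 3 r) φ hφ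
  rw [hS, ← hα] at h1
  refine ⟨⟨h1.1 h.map, hrS, ?_, fun x hx hx' => ?_⟩, r3⟩
  · have := h.root; omega
  · rw [← (h5 x hx).2 hx']
    refine h.quad x (Finset.mem_sdiff.1 hx).1 fun h' => hx' ((h5 x hx).1.2 (Or.inl h'))

end Glue

end Quad

section Bridge

variable {X : Type*} [DecidableEq X] {S T : Finset X} {φ α φ₁ φ₂ α₁ α₂ : Perm X} {r s t : X}

/-- The two sides of a bridge are determined by the map. -/
lemma bridge_injective {S' T' : Finset X} {φ₁' φ₂' α₁' α₂' : Perm X} {a b a' b' : ℕ}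
    (h₁ : IsQ S r a φ₁ α₁) (h₂ : IsQ T t b φ₂ α₂) (hST : Disjoint S T)
    (h₁' : IsQ S' r a' φ₁' α₁') (h₂' : IsQ T' t b' φ₂' α₂') (hST' : Disjoint S' T')
    (hφ : φ₁ * φ₂ * swap r s * swap s t = φ₁' * φ₂' * swap r s * swap s t)
    (hα : α₁ * α₂ * swap s t = α₁' * α₂' * swap s t) :
    S = S' ∧ a = a' ∧ b = b' ∧ φ₁ = φ₁' ∧ φ₂ = φ₂' ∧ α₁ = α₁' ∧ α₂ = α₂' := by
  simp only [mul_left_inj] at hφ hα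
  have mem : ∀ {S T : Finset X} {φ₁ φ₂ α₁ α₂ : Perm X} {a b : ℕ}, IsQ S r a φ₁ α₁ →
      IsQ T t b φ₂ α₂ → Disjoint S T → ∀ x, x ∈ S ↔ comp (φ₁ * φ₂) (α₁ * α₂) r x := by
    intro S T φ₁ φ₂ α₁ α₂ a b h₁ h₂ hST x
    rw [comp_mul_of_disjoint_rel (Finset.disjoint_coe.2 hST) h₁.map.φ_out h₂.map.φ_out
      h₁.map.α_out h₂.map.α_out]
    refine ⟨fun hx => Or.inl (h₁.map.conn r h₁.mem x hx), fun hx => ?_⟩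
    rcases hx with hx | hx
    · by_contra hc
      exact hc (comp_trivial_of_out (S := (S : Set X)) h₁.map.φ_out h₁.map.α_out hx (Or.inr hc) ▸
        h₁.mem)
    · have hr : r ∉ T := Finset.disjoint_left.1 hST h₁.mem
      exact comp_trivial_of_out (S := (T : Set X)) h₂.map.φ_out h₂.map.α_out hx (Or.inl hr) ▸ h₁.mem
  have hS : S = S' := by
    ext x
    rw [mem h₁ h₂ hST, mem h₁' h₂' hST', hφ, hα]
  subst hS
  have eq : ∀ {π₁ π₂ π₁' π₂' : Perm X}, (∀ x ∉ S, π₁ x = x) → (∀ x ∉ T, π₂ x = x) →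
      (∀ x ∉ S, π₁' x = x) → (∀ x ∉ T', π₂' x = x) → π₁ * π₂ = π₁' * π₂' →
      π₁ = π₁' ∧ π₂ = π₂' := by
    intro π₁ π₂ π₁' π₂' g1 g2 g1' g2' he
    have : π₁ = π₁' := by
      refine Equiv.ext fun x => ?_
      by_cases hx : x ∈ S
      · have := DFunLike.congr_fun he x
        rwa [Perm.mul_apply, Perm.mul_apply, g2 x (Finset.disjoint_left.1 hST hx),
          g2' x (Finset.disjoint_left.1 hST' hx)] at this
      · rw [g1 x hx, g1' x hx]
    refine ⟨this, ?_⟩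
    rwa [this, mul_right_inj] at he
  obtain ⟨f1, f2⟩ := eq h₁.map.φ_out h₂.map.φ_out h₁'.map.φ_out h₂'.map.φ_out hφ
  obtain ⟨f3, f4⟩ := eq h₁.map.α_out h₂.map.α_out h₁'.map.α_out h₂'.map.α_out hα
  subst f1 f2 f3 f4
  have := h₁.root
  have := h₁'.root
  have := h₂.root
  have := h₂'.root
  exact ⟨rfl, by omega, by omega, rfl, rfl, rfl, rfl⟩

variable [Finite X]

lemma bridge_aux (hST : Disjoint S T) (hsS : s ∉ S) (hsT : s ∉ T) (hr : r ∈ S) (ht : t ∈ T)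
    (hφ₁ : ∀ x ∉ S, φ₁ x = x) (hφ₂ : ∀ x ∉ T, φ₂ x = x) (ψ : Perm X)
    (hψ : ψ = φ₁ * φ₂ * swap r s * swap s t) :
    ψ r = s ∧ cyc ψ r t ∧
    classSize (cyc ψ) r = classSize (cyc φ₁) r + 1 + classSize (cyc φ₂) t ∧
    (∀ x ∈ S, (cyc ψ r x ↔ cyc φ₁ r x) ∧
      (¬ cyc φ₁ r x → classSize (cyc ψ) x = classSize (cyc φ₁) x)) ∧
    (∀ x ∈ T, (cyc ψ r x ↔ cyc φ₂ t x) ∧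
      (¬ cyc φ₂ t x → classSize (cyc ψ) x = classSize (cyc φ₂) x)) := by
  have hST' : Disjoint (S : Set X) T := Finset.disjoint_coe.2 hST
  have hrs : r ≠ s := ne_of_mem_of_not_mem hr hsS
  have hts : t ≠ s := ne_of_mem_of_not_mem ht hsT
  have hrT : r ∉ T := Finset.disjoint_left.1 hST hr
  have htS : t ∉ S := Finset.disjoint_right.1 hST ht
  have hrt : r ≠ t := ne_of_mem_of_not_mem hr htS
  have hrel {x y : X} := cyc_mul_of_disjoint_rel hST' hφ₁ hφ₂ (x := x) (y := y)
  have c1 {x y : X} (h : cyc φ₁ x y) (h' : x ∉ S ∨ y ∉ S) : x = y :=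
    cyc_trivial_of_out (S := (S : Set X)) hφ₁ h h'
  have c2 {x y : X} (h : cyc φ₂ x y) (h' : x ∉ T ∨ y ∉ T) : x = y :=
    cyc_trivial_of_out (S := (T : Set X)) hφ₂ h h'
  have relS : ∀ x ∈ S, ∀ y, cyc (φ₁ * φ₂) x y ↔ cyc φ₁ x y := fun x hx y => by
    rw [hrel]
    refine ⟨fun h => h.elim id fun h => ?_, Or.inl⟩
    rw [c2 h (Or.inl (Finset.disjoint_left.1 hST hx))]
  have relT : ∀ x ∈ T, ∀ y, cyc (φ₁ * φ₂) x y ↔ cyc φ₂ x y := fun x hx y => by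
    rw [hrel]
    refine ⟨fun h => h.elim (fun h => ?_) id, Or.inr⟩
    rw [c1 h (Or.inl (Finset.disjoint_right.1 hST hx))]
  have fs : (φ₁ * φ₂) s = s := by rw [Perm.mul_apply, hφ₂ s hsT, hφ₁ s hsS]
  have trivs : ∀ z, cyc (φ₁ * φ₂) s z → s = z := fun z h => fixed_of_cyc fs h
  have hu : cyc (φ₁ * φ₂ * swap r s) = cyc (φ₁ * φ₂) ⊔ cyc (swap r s) := cyc_mul_swap_fixed fs hrs
  have hnot : ¬ cyc (φ₁ * φ₂ * swap r s) s t := by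
    rw [hu, sup_swap_rel]
    rintro (h | ⟨h, _⟩ | ⟨_, h⟩)
    · exact hts (trivs t h).symm
    · exact hrs (trivs r h).symm
    · exact htS ((fun h' => h' ▸ hr) (c1 ((relS r hr t).1 h) (Or.inr htS)))
  have hv : cyc ψ = cyc (φ₁ * φ₂) ⊔ cyc (swap r s) ⊔ cyc (swap s t) := by
    rw [hψ, cyc_mul_swap_of_not hnot, hu]
  have hψrs : cyc ψ r s := by rw [hv]; exact sup_left_rel (sup_right_rel (cyc_swap_rel r s))
  have hψst : cyc ψ s t := by rw [hv]; exact sup_right_rel (cyc_swap_rel s t)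
  have hψrt := Setoid.trans' _ hψrs hψst
  have general : ∀ x, x ≠ s → ¬ cyc (φ₁ * φ₂) x r → ¬ cyc (φ₁ * φ₂) x t →
      ∀ z, cyc ψ x z ↔ cyc (φ₁ * φ₂) x z := by
    intro x hx hxr hxt z
    have hxs : ¬ cyc (φ₁ * φ₂) x s := fun h => hx (trivs x (Setoid.symm' _ h)).symm
    rw [hv, sup_swap_rel_of_not, sup_swap_rel_of_not hxr hxs]
    · rwa [sup_swap_rel_of_not hxr hxs]
    · rwa [sup_swap_rel_of_not hxr hxs]
  have hle {x y : X} (h : cyc (φ₁ * φ₂) x y) : cyc ψ x y := by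
    rw [hv]; exact sup_left_rel (sup_left_rel h)
  refine ⟨?_, hψrt, ?_, fun x hx => ?_, fun x hx => ?_⟩
  · rw [hψ, mul_swap_apply_of_ne _ hrs hrt, mul_swap_apply_left, fs]
  · rw [classSize_eq_of_rel hψrs, hv, ← hu, classSize_sup_swap hnot, hu,
      ← classSize_eq_of_rel (sup_right_rel (cyc_swap_rel r s)),
      classSize_sup_swap (fun h => hrs (trivs r (Setoid.symm' _ h)).symm),
      classSize_eq_one (x := s) trivs, classSize_congr (relS r hr), ← hu]
    congr 1
    refine classSize_congr fun z => ?_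
    rw [hu, sup_swap_rel_of_not, relT t ht]
    · exact fun h => htS ((fun h' => h' ▸ hr)
        (c1 ((relS r hr t).1 (Setoid.symm' _ h)) (Or.inr htS)))
    · exact fun h => hts (trivs t (Setoid.symm' _ h)).symm
  · have hxs : x ≠ s := ne_of_mem_of_not_mem hx hsS
    have hxt : ¬ cyc (φ₁ * φ₂) x t := fun h =>
      htS ((fun h' => h' ▸ hx) (c1 ((relS x hx t).1 h) (Or.inr htS)))
    have hgen := fun (h : ¬ cyc φ₁ r x) => general x hxs
      (fun h' => h (Setoid.symm' _ ((relS x hx r).1 h'))) hxt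
    refine ⟨⟨fun h => ?_, fun h => hle ((relS r hr x).2 h)⟩, fun h => classSize_congr fun z => ?_⟩
    · by_contra hc
      exact hc (Setoid.symm' _ ((relS x hx r).1 ((hgen hc r).1 (Setoid.symm' _ h))))
    · rw [hgen h, relS x hx]
  · have hxs : x ≠ s := ne_of_mem_of_not_mem hx hsT
    have hxr : ¬ cyc (φ₁ * φ₂) x r := fun h =>
      hrT ((fun h' => h' ▸ hx) (c2 ((relT x hx r).1 h) (Or.inr hrT)))
    have hgen := fun (h : ¬ cyc φ₂ t x) => general x hxs hxr
      (fun h' => h (Setoid.symm' _ ((relT x hx t).1 h')))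
    refine ⟨⟨fun h => ?_, fun h => Setoid.trans' _ hψrt (hle ((relT t ht x).2 h))⟩,
      fun h => classSize_congr fun z => ?_⟩
    · by_contra hc
      have := (hgen hc r).1 (Setoid.symm' _ h)
      exact hxr this
    · rw [hgen h, relT x hx]

lemma bridge_forward {a b : ℕ} (h₁ : IsQ S r a φ₁ α₁) (h₂ : IsQ T t b φ₂ α₂)
    (hST : Disjoint S T) (hsS : s ∉ S) (hsT : s ∉ T) (ψ : Perm X)
    (hψ : ψ = φ₁ * φ₂ * swap r s * swap s t) :
    IsQ (insert s (S ∪ T)) r (a + b + 1) ψ (α₁ * α₂ * swap s t) ∧ ψ r = s ∧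
      (α₁ * α₂ * swap s t) s = t ∧ cyc ψ r t := by
  obtain ⟨e1, e2, e3, e4, e5⟩ :=
    bridge_aux hST hsS hsT h₁.mem h₂.mem h₁.map.φ_out h₂.map.φ_out ψ hψ
  refine ⟨⟨?_, by simp [h₁.mem], ?_, fun x hx hx' => ?_⟩, e1, ?_, e2⟩
  · rw [hψ, isMap_bridge hST hsS hsT h₁.mem h₂.mem h₁.map.φ_out h₂.map.φ_out h₁.map.α_out
      h₂.map.α_out h₂.apply_leg]
    exact ⟨h₁.map, h₂.map⟩
  · rw [e3, h₁.root, h₂.root]; ring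
  · simp only [Finset.mem_insert, Finset.mem_union] at hx
    rcases hx with rfl | hx | hx
    · exact absurd (by simpa [e1] using cyc_apply ψ r) hx'
    · rw [(e4 x hx).1] at hx'
      rw [(e4 x hx).2 hx', h₁.quad x hx hx']
    · rw [(e5 x hx).1] at hx'
      rw [(e5 x hx).2 hx', h₂.quad x hx hx']
  · rw [mul_swap_apply_left, Perm.mul_apply, h₂.apply_leg, h₁.map.α_out]
    exact Finset.disjoint_right.1 hST h₂.mem

lemma bridge_backward {p : ℕ} (h : IsQ S r (p + 1) φ α) (hs : φ r = s) (ht : α s = t)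
    (hrt' : cyc φ r t) :
    ∃ (S₁ S₂ : Finset X) (a b : ℕ) (φ₁ φ₂ α₁ α₂ : Perm X), IsQ S₁ r a φ₁ α₁ ∧ IsQ S₂ t b φ₂ α₂ ∧
      Disjoint S₁ S₂ ∧ s ∉ S₁ ∧ s ∉ S₂ ∧ insert s (S₁ ∪ S₂) = S ∧ a + b = p ∧
      φ = φ₁ * φ₂ * swap r s * swap s t ∧ α = α₁ * α₂ * swap s t := by
  classical
  obtain ⟨hsS, htS, hrs, hrt, hst⟩ := h.apply_root hs ht
  have hcrs : cyc φ r s := by simpa [hs] using cyc_apply φ r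
  have hcst : cyc φ s t := Setoid.trans' _ (Setoid.symm' _ hcrs) hrt'
  set χ := φ * swap s t * swap r s with hχ
  set β := α * swap s t with hβ
  have hφχ : φ = χ * swap r s * swap s t := by rw [hχ]; simp only [mul_swap_mul_self]
  have hαβ : α = β * swap s t := by rw [hβ, mul_swap_mul_self]
  have hts : α t = s := by rw [← ht, h.map.α_inv]
  have βs : β s = s := by rw [hβ, mul_swap_apply_left, hts]
  have βt : β t = t := by rw [hβ, mul_swap_apply_right, ht]
  have χs : χ s = s := by rw [hχ, mul_swap_apply_right, mul_swap_apply_of_ne _ hrs hrt, hs]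
  have hnot : ¬ cyc (χ * swap r s) s t := by
    rw [hχ, mul_swap_mul_self]
    exact not_cyc_mul_swap hst hcst
  have hpl := h.map.planar
  rw [hφχ, hαβ, planar_join_of_not βs βt hst hnot, comp_insert χs hrs] at hpl
  have hncomp : ¬ comp χ β r t := fun hc => hpl.2
    (Setoid.trans' _ (Setoid.symm' _ (sup_right_rel (cyc_swap_rel r s))) (sup_left_rel hc))
  have htrivs : ∀ x, comp χ β x s → x = s := fun x hx => (comp_fixed χs βs (Setoid.symm' _ hx)).symm
  have χout : ∀ x ∉ S, χ x = x := fun x hx => by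
    have h1 := (ne_of_mem_of_not_mem hsS hx).symm
    rw [hχ, mul_swap_apply_of_ne _ (ne_of_mem_of_not_mem h.mem hx).symm h1,
      mul_swap_apply_of_ne _ h1 (ne_of_mem_of_not_mem htS hx).symm, h.map.φ_out x hx]
  have βout : ∀ x ∉ S, β x = x := fun x hx => by
    rw [hβ, mul_swap_apply_of_ne _ (ne_of_mem_of_not_mem hsS hx).symm
      (ne_of_mem_of_not_mem htS hx).symm, h.map.α_out x hx]
  have hcout : ∀ x ∉ S, ¬ comp χ β r x := fun x hx hc => by
    have := comp_fixed (χout x hx) (βout x hx) (Setoid.symm' _ hc)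
    exact hx (this ▸ h.mem)
  set S₁ := S.filter (fun x => comp χ β r x) with hS₁
  set S₂ := S.filter (fun x => ¬ comp χ β r x ∧ x ≠ s) with hS₂
  have hmem1 : ∀ x, x ∈ S₁ ↔ comp χ β r x := fun x => by
    rw [hS₁, Finset.mem_filter]
    exact ⟨And.right, fun hc => ⟨by_contra fun hx => hcout x hx hc, hc⟩⟩
  have hmem2 : ∀ x, x ∉ S₁ → x ∉ S₂ → x ∉ S ∨ x = s := fun x h1 h2 => by
    by_cases hx : x ∈ S
    · rw [hS₂, Finset.mem_filter] at h2
      rw [hmem1] at h1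
      tauto
    · exact Or.inl hx
  have hdis : Disjoint S₁ S₂ := by
    rw [Finset.disjoint_left]
    intro x h1 h2
    rw [hmem1] at h1
    exact (Finset.mem_filter.1 h2).2.1 h1
  have hs1 : s ∉ S₁ := by
    rw [hmem1]
    exact fun hc => hrs (htrivs r hc)
  have hs2 : s ∉ S₂ := by simp [hS₂]
  have hr1 : r ∈ S₁ := (hmem1 r).2 (Setoid.refl' _ r)
  have ht2 : t ∈ S₂ := by
    rw [hS₂, Finset.mem_filter]
    exact ⟨htS, hncomp, hst.symm⟩
  have hunion : insert s (S₁ ∪ S₂) = S := by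
    ext x
    rw [Finset.mem_insert, Finset.mem_union]
    constructor
    · rintro (rfl | hx | hx)
      exacts [hsS, (Finset.mem_filter.1 hx).1, (Finset.mem_filter.1 hx).1]
    · intro hx
      by_contra! hc
      exact (hmem2 x hc.2.1 hc.2.2).elim (fun h' => h' hx) hc.1
  have hdis' : Disjoint (S₁ : Set X) S₂ := Finset.disjoint_coe.2 hdis
  obtain ⟨φ₁, φ₂, hφ₁, hφ₂, hφ⟩ := exists_mul_of_stable (π := χ) (S := S₁) (T := S₂) (fun x => by
      simp only [Finset.mem_coe, hmem1]
      have : comp χ β x (χ x) := sup_left_rel (cyc_apply χ x)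
      exact ⟨fun hc => Setoid.trans' _ hc (Setoid.symm' _ this), fun hc => Setoid.trans' _ hc this⟩)
    (fun x h1 h2 => (hmem2 x h1 h2).elim (χout x) (fun h' => by rw [h', χs]))
  obtain ⟨α₁, α₂, hα₁, hα₂, hα⟩ := exists_mul_of_stable (π := β) (S := S₁) (T := S₂) (fun x => by
      simp only [Finset.mem_coe, hmem1]
      have : comp χ β x (β x) := sup_right_rel (cyc_apply β x)
      exact ⟨fun hc => Setoid.trans' _ hc (Setoid.symm' _ this), fun hc => Setoid.trans' _ hc this⟩)
    (fun x h1 h2 => (hmem2 x h1 h2).elim (βout x) (fun h' => by rw [h', βs]))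
  simp only [Finset.mem_coe] at hφ₁ hφ₂ hα₁ hα₂
  have α₂t : α₂ t = t := by
    have : α₁ (α₂ t) = t := by rw [← Perm.mul_apply, ← hα, βt]
    rwa [hα₁] at this
    exact Finset.disjoint_right.1 hdis (apply_mem_of_out (S := (S₂ : Set X)) hα₂ ht2)
  rw [hφ] at hφχ
  rw [hα] at hαβ
  have hmap := h.map
  rw [← hunion, hφχ, hαβ, isMap_bridge hdis hs1 hs2 hr1 ht2 hφ₁ hφ₂ hα₁ hα₂ α₂t] at hmap
  obtain ⟨-, -, e3, e4, e5⟩ := bridge_aux hdis hs1 hs2 hr1 ht2 hφ₁ hφ₂ φ hφχ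
  have q1 : ∀ x ∈ S₁, ¬ cyc φ₁ r x → classSize (cyc φ₁) x = 4 := fun x hx hx' => by
    rw [← (e4 x hx).2 hx']
    exact h.quad x (Finset.mem_filter.1 hx).1 fun hc => hx' ((e4 x hx).1.1 hc)
  have q2 : ∀ x ∈ S₂, ¬ cyc φ₂ t x → classSize (cyc φ₂) x = 4 := fun x hx hx' => by
    rw [← (e5 x hx).2 hx']
    exact h.quad x (Finset.mem_filter.1 hx).1 fun hc => hx' ((e5 x hx).1.1 hc)
  obtain ⟨a, ha⟩ := odd_root_degree hmap.1 hr1 q1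
  obtain ⟨b, hb⟩ := odd_root_degree hmap.2 ht2 q2
  have hroot := h.root
  exact ⟨S₁, S₂, a, b, φ₁, φ₂, α₁, α₂, ⟨hmap.1, hr1, ha, q1⟩, ⟨hmap.2, ht2, hb, q2⟩, hdis, hs1, hs2,
    hunion, by omega, hφχ, hαβ⟩

end Bridge

section Count

variable {X : Type*} {S : Finset X} {φ α : Perm X} {r s t : X} {p : ℕ}

lemma isQ_zero_iff [Finite X] : IsQ S r 0 φ α ↔ S = {r} ∧ φ = 1 ∧ α = 1 := by
  constructor
  · intro h
    have hφr : φ r = r := by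
      have h1 := h.root
      rw [classSize_cyc, Function.minimalPeriod_eq_one_iff_isFixedPt] at h1
      exact h1
    have hS : S = {r} := by
      ext x
      rw [Finset.mem_singleton]
      exact ⟨fun hx => (comp_fixed hφr h.apply_leg (h.map.conn r h.mem x hx)).symm,
        fun hx => hx ▸ h.mem⟩
    subst hS
    have : ∀ π : Perm X, (∀ x ∉ ({r} : Finset X), π x = x) → π r = r → π = 1 := by
      intro π h1 h2
      refine Equiv.ext fun x => ?_
      by_cases hx : x = r
      · rw [hx, h2]; rfl
      · exact h1 x (by simpa using hx)
    exact ⟨rfl, this φ h.map.φ_out hφr, this α h.map.α_out h.apply_leg⟩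
  · rintro ⟨rfl, rfl, rfl⟩
    refine ⟨⟨fun _ _ => rfl, fun _ _ => rfl, fun _ => rfl, fun x hx => ?_, fun x hx y hy => ?_, ?_⟩,
      by simp, ?_, fun x hx h => ?_⟩
    · simpa using hx
    · rw [Finset.mem_singleton] at hx hy
      rw [hx, hy]
    · unfold Planar
      rw [mul_one, comp_one, cyc_one, numClasses_bot]
      ring
    · rw [cyc_one]
      exact classSize_eq_one fun _ h => h
    · rw [Finset.mem_singleton] at hx
      exact absurd (hx ▸ Setoid.refl' _ _) h

variable [DecidableEq X] [Fintype X]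

open Classical in
/-- The finite set of quadrangulations with a boundary on a given dart set. -/
noncomputable def quadSet (S : Finset X) (r : X) (p : ℕ) : Finset (Perm X × Perm X) :=
  Finset.univ.filter fun x => IsQ S r p x.1 x.2

lemma mem_quadSet {x : Perm X × Perm X} : x ∈ quadSet S r p ↔ IsQ S r p x.1 x.2 := by
  simp [quadSet]

open Classical in
lemma card_glue (hs : s ∈ S) (ht : t ∈ S) (hst : s ≠ t) :
    ((quadSet S r (p + 1)).filter fun x => (x.1 r = s ∧ x.2 s = t) ∧ ¬ cyc x.1 r t).card =
      (quadSet (S \ {s, t}) r (p + 2)).card := by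
  have hS : insert s (insert t (S \ {s, t})) = S := by
    ext x
    simp only [Finset.mem_insert, Finset.mem_sdiff, Finset.mem_singleton]
    constructor
    · rintro (rfl | rfl | h)
      exacts [hs, ht, h.1]
    · tauto
  refine Finset.card_bij'
    (fun x _ => (x.1 * swap s t * swap r s * swap ((x.1 ^ 3) t) t, x.2 * swap s t))
    (fun x _ => (x.1 * swap ((x.1 ^ 3) r) t * swap r s * swap s t, x.2 * swap s t))
    (fun x hx => ?_) (fun x hx => ?_) (fun x hx => ?_) (fun x hx => ?_)
  · rw [Finset.mem_filter, mem_quadSet] at hx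
    rw [mem_quadSet]
    exact (glue_backward hx.1 hx.2.1.1 hx.2.1.2 hx.2.2 _ rfl).1
  · rw [mem_quadSet] at hx
    rw [Finset.mem_filter, mem_quadSet]
    obtain ⟨h1, h2, h3, h4, -⟩ := glue_forward hx (by simp) (by simp) hst _ rfl
    rw [hS] at h1
    exact ⟨h1, ⟨h2, h3⟩, h4⟩
  · rw [Finset.mem_filter, mem_quadSet] at hx
    have h := (glue_backward hx.1 hx.2.1.1 hx.2.1.2 hx.2.2 _ rfl).2
    simp only [h, mul_swap_mul_self, Prod.mk.eta]
  · rw [mem_quadSet] at hx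
    have h := (glue_forward hx (by simp) (by simp) hst _ rfl).2.2.2.2
    simp only [h, mul_swap_mul_self, Prod.mk.eta]

open Classical in
lemma card_bridge (hr : r ∈ S) (hs : s ∈ S) (ht : t ∈ S) (hrs : r ≠ s) (hrt : r ≠ t)
    (hst : s ≠ t) :
    ((quadSet S r (p + 1)).filter fun x => (x.1 r = s ∧ x.2 s = t) ∧ cyc x.1 r t).card =
      ∑ V ∈ (S \ {r, s, t}).powerset, ∑ ab ∈ Finset.HasAntidiagonal.antidiagonal p,
        (quadSet (insert r V) r ab.1).card * (quadSet (insert t ((S \ {r, s, t}) \ V)) t ab.2).card := by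
  have hdisj : ∀ V ∈ (S \ {r, s, t}).powerset,
      Disjoint (insert r V) (insert t ((S \ {r, s, t}) \ V)) ∧ s ∉ insert r V ∧
      s ∉ insert t ((S \ {r, s, t}) \ V) ∧
      insert s (insert r V ∪ insert t ((S \ {r, s, t}) \ V)) = S := by
    intro V hV
    rw [Finset.mem_powerset] at hV
    have hV' : ∀ x ∈ V, x ∈ S ∧ x ≠ r ∧ x ≠ s ∧ x ≠ t := fun x hx => by
      simpa [not_or] using hV hx
    refine ⟨?_, ?_, ?_, ?_⟩
    · rw [Finset.disjoint_left]
      intro x hx hx'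
      simp only [Finset.mem_insert, Finset.mem_sdiff, Finset.mem_singleton] at hx hx'
      rcases hx with rfl | hx
      · rcases hx' with h | h
        exacts [hrt h, h.1.2 (Or.inl rfl)]
      · rcases hx' with h | h
        exacts [(hV' x hx).2.2.2 h, h.2 hx]
    · rw [Finset.mem_insert, not_or]
      exact ⟨hrs.symm, fun h => (hV' s h).2.2.1 rfl⟩
    · simp [hst]
    · ext x
      simp only [Finset.mem_insert, Finset.mem_union, Finset.mem_sdiff, Finset.mem_singleton]
      constructor
      · rintro (rfl | (rfl | h) | (rfl | h))
        exacts [hs, hr, (hV' x h).1, ht, h.1.1]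
      · tauto
  simp_rw [← Finset.card_product]
  simp_rw [← Finset.card_sigma]
  symm
  refine Finset.card_bij (fun x _ => (x.2.2.1.1 * x.2.2.2.1 * swap r s * swap s t,
    x.2.2.1.2 * x.2.2.2.2 * swap s t)) ?_ ?_ ?_
  · rintro ⟨V, ⟨a, b⟩, ⟨φ₁, α₁⟩, ⟨φ₂, α₂⟩⟩ hx
    simp only [Finset.mem_sigma, Finset.mem_product, mem_quadSet, Finset.HasAntidiagonal.mem_antidiagonal] at hx
    obtain ⟨hV, hab, h1, h2⟩ := hx
    obtain ⟨d1, d2, d3, d4⟩ := hdisj V hV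
    obtain ⟨e1, e2, e3, e4⟩ := bridge_forward h1 h2 d1 d2 d3 _ rfl
    rw [d4, hab] at e1
    rw [Finset.mem_filter, mem_quadSet]
    exact ⟨e1, ⟨e2, e3⟩, e4⟩
  · rintro ⟨V, ⟨a, b⟩, ⟨φ₁, α₁⟩, ⟨φ₂, α₂⟩⟩ hx ⟨V', ⟨a', b'⟩, ⟨φ₁', α₁'⟩, ⟨φ₂', α₂'⟩⟩ hx' he
    simp only [Finset.mem_sigma, Finset.mem_product, mem_quadSet] at hx hx'
    simp only [Prod.mk.injEq] at he
    obtain ⟨h0, rfl, rfl, rfl, rfl, rfl, rfl⟩ := bridge_injective hx.2.2.1 hx.2.2.2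
      (hdisj V hx.1).1 hx'.2.2.1 hx'.2.2.2 (hdisj V' hx'.1).1 he.1 he.2
    have hrV : ∀ V ∈ (S \ {r, s, t}).powerset, r ∉ V := fun V hV h => by
      simpa using Finset.mem_powerset.1 hV h
    have : V = V' := by
      rw [← Finset.erase_insert (hrV V hx.1), h0, Finset.erase_insert (hrV V' hx'.1)]
    rw [this]
  · rintro ⟨φ, α⟩ hx
    rw [Finset.mem_filter, mem_quadSet] at hx
    obtain ⟨S₁, S₂, a, b, φ₁, φ₂, α₁, α₂, h1, h2, d1, d2, d3, d4, hab, e1, e2⟩ :=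
      bridge_backward hx.1 hx.2.1.1 hx.2.1.2 hx.2.2
    have hd := Finset.disjoint_left.1 d1
    have hU : ∀ x, x ∈ S ↔ x = s ∨ x ∈ S₁ ∨ x ∈ S₂ := fun x => by
      rw [← d4, Finset.mem_insert, Finset.mem_union]
    have hS₁ : insert r (S₁.erase r) = S₁ := Finset.insert_erase h1.mem
    have hS₂ : insert t ((S \ {r, s, t}) \ S₁.erase r) = S₂ := by
      ext x
      simp only [Finset.mem_insert, Finset.mem_sdiff, Finset.mem_singleton, Finset.mem_erase, hU]
      have := h1.mem
      have := h2.mem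
      by_cases hxt : x = t
      · subst hxt; tauto
      · by_cases hxs : x = s
        · subst hxs; tauto
        · have := @hd x
          by_cases hxr : x = r
          · subst hxr; tauto
          · tauto
    refine ⟨⟨S₁.erase r, (a, b), (φ₁, α₁), (φ₂, α₂)⟩, ?_, ?_⟩
    · simp only [Finset.mem_sigma, Finset.mem_product, mem_quadSet, Finset.HasAntidiagonal.mem_antidiagonal, hS₁,
        hS₂, Finset.mem_powerset]
      refine ⟨fun x hx => ?_, hab, h1, h2⟩
      rw [Finset.mem_erase] at hx
      simp only [Finset.mem_sdiff, Finset.mem_insert, Finset.mem_singleton, hU, not_or]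
      exact ⟨Or.inr (Or.inl hx.2), hx.1, fun h => d2 (h ▸ hx.2), fun h => hd hx.2 (h ▸ h2.mem)⟩
    · exact (Prod.ext e1 e2).symm

/-- The numbers of quadrangulations with a boundary satisfy Tutte's recursion. -/
theorem card_quadSet {f : ℕ → ℕ → ℚ} (h00 : f 0 0 = 1) (h0 : ∀ p, f 0 (p + 1) = 0)
    (h1 : ∀ p, f 1 (p + 1) = 0) (hz : ∀ m, f (m + 1) 0 = 0)
    (hrec : ∀ m p, f (m + 2) (p + 1) = ∑ ij ∈ Finset.HasAntidiagonal.antidiagonal m,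
      ∑ ab ∈ Finset.HasAntidiagonal.antidiagonal p, f ij.1 ab.1 * f ij.2 ab.2 + f m (p + 2)) (m : ℕ) :
    ∀ (S : Finset X) (r : X) (p : ℕ), r ∈ S → S.card = m + 1 →
      ((quadSet S r p).card : ℚ) = m.factorial * f m p := by
  classical
  induction m using Nat.strong_induction_on with
  | _ m ih =>
  intro S r p hr hS
  rcases p with _ | p
  · rcases m with _ | m
    · obtain ⟨r', rfl⟩ := Finset.card_eq_one.1 hS
      rw [Finset.mem_singleton] at hr
      subst hr
      have : quadSet {r} r 0 = {((1 : Perm X), (1 : Perm X))} := by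
        ext ⟨x, y⟩
        rw [mem_quadSet, isQ_zero_iff]
        simp
      rw [this, h00]
      simp
    · have : quadSet S r 0 = ∅ := by
        rw [Finset.eq_empty_iff_forall_notMem]
        intro x hx
        rw [mem_quadSet, isQ_zero_iff] at hx
        rw [hx.1] at hS
        simp at hS
      rw [this, hz]
      simp
  have hmaps : ∀ x ∈ quadSet S r (p + 1), (x.1 r, x.2 (x.1 r)) ∈ (S.erase r).offDiag := by
    intro x hx
    rw [mem_quadSet] at hx
    obtain ⟨e1, e2, e3, e4, e5⟩ := hx.apply_root rfl rfl
    rw [Finset.mem_offDiag]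
    exact ⟨Finset.mem_erase.2 ⟨e3.symm, e1⟩, Finset.mem_erase.2 ⟨e4.symm, e2⟩, e5⟩
  have hcard : (S.erase r).card = m := by rw [Finset.card_erase_of_mem hr, hS]; rfl
  rw [Finset.card_eq_sum_card_fiberwise hmaps]
  rcases m with _ | _ | m
  · rw [Finset.card_eq_zero] at hcard
    rw [hcard, h0]
    simp
  · have : (S.erase r).offDiag = ∅ := by
      rw [← Finset.card_eq_zero, Finset.offDiag_card, hcard]
    rw [this, h1]
    simp
  have key : ∀ st ∈ (S.erase r).offDiag,
      (((quadSet S r (p + 1)).filter fun x => (x.1 r, x.2 (x.1 r)) = st).card : ℚ) =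
        m.factorial * f (m + 2) (p + 1) := by
    rintro ⟨s, t⟩ hst'
    rw [Finset.mem_offDiag, Finset.mem_erase, Finset.mem_erase] at hst'
    obtain ⟨⟨hrs, hs⟩, ⟨hrt, ht⟩, hst⟩ := hst'
    simp only at hrs hs hrt ht hst
    have e1 : (quadSet S r (p + 1)).filter (fun x => (x.1 r, x.2 (x.1 r)) = (s, t)) =
        (quadSet S r (p + 1)).filter (fun x => x.1 r = s ∧ x.2 s = t) := by
      refine Finset.filter_congr fun x _ => ?_
      rw [Prod.mk.injEq]
      constructor
      · rintro ⟨rfl, h⟩; exact ⟨rfl, h⟩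
      · rintro ⟨rfl, h⟩; exact ⟨rfl, h⟩
    have e2 : (S \ {s, t}).card = m + 1 := by
      rw [Finset.card_sdiff_of_subset (by simp [Finset.insert_subset_iff, hs, ht]), hS,
        Finset.card_pair hst]
      omega
    have e3 : (S \ {r, s, t}).card = m := by
      rw [Finset.card_sdiff_of_subset (by simp [Finset.insert_subset_iff, hs, ht, hr]), hS,
        Finset.card_eq_three.2 ⟨r, s, t, hrs.symm, hrt.symm, hst, rfl⟩]
      omega
    rw [e1, ← Finset.card_filter_add_card_filter_not (fun x => cyc x.1 r t), Finset.filter_filter,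
      Finset.filter_filter, card_glue hs ht hst, card_bridge hr hs ht hrs.symm hrt.symm hst,
      Nat.cast_add, ih m (by omega) (S \ {s, t}) r (p + 2) (by simp [hr, hrs.symm, hrt.symm]) e2,
      hrec, mul_add]
    congr 1
    push_cast
    obtain ⟨g, hg⟩ : ∃ g : ℕ → ℚ, ∀ i, g i = ∑ ab ∈ Finset.HasAntidiagonal.antidiagonal p,
      (i.factorial * f i ab.1) * ((m - i).factorial * f (m - i) ab.2) := ⟨_, fun _ => rfl⟩
    have e4 : ∀ V ∈ (S \ {r, s, t}).powerset,
        (∑ ab ∈ Finset.HasAntidiagonal.antidiagonal p, ((quadSet (insert r V) r ab.1).card : ℚ) *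
          (quadSet (insert t ((S \ {r, s, t}) \ V)) t ab.2).card) =
        g V.card := by
      intro V hV
      rw [hg]
      rw [Finset.mem_powerset] at hV
      have hVm : V.card ≤ m := e3 ▸ Finset.card_le_card hV
      refine Finset.sum_congr rfl fun ab _ => ?_
      rw [ih V.card (by omega) (insert r V) r ab.1 (by simp)
          (Finset.card_insert_of_notMem fun h => by simpa using hV h),
        ih (m - V.card) (by omega) (insert t _) t ab.2 (by simp)
          (by rw [Finset.card_insert_of_notMem (by simp), Finset.card_sdiff_of_subset hV, e3])]
    rw [Finset.sum_congr rfl e4, Finset.sum_powerset_apply_card, e3,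
      Finset.Nat.sum_antidiagonal_eq_sum_range_succ
        (fun i j => ∑ ab ∈ Finset.HasAntidiagonal.antidiagonal p, f i ab.1 * f j ab.2) m, Finset.mul_sum]
    refine Finset.sum_congr rfl fun i hi => ?_
    have hi' : i ≤ m := by simpa [Nat.lt_succ_iff] using hi
    rw [hg, nsmul_eq_mul, Finset.mul_sum, Finset.mul_sum]
    refine Finset.sum_congr rfl fun ab _ => ?_
    rw [← Nat.choose_mul_factorial_mul_factorial hi']
    push_cast
    ring
  push_cast
  rw [Finset.sum_congr rfl key, Finset.sum_const, Finset.offDiag_card, hcard, nsmul_eq_mul,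
    show (m + 2) * (m + 2) - (m + 2) = (m + 2) * (m + 1) by rw [← Nat.mul_sub_one]; rfl,
    Nat.factorial_succ, Nat.factorial_succ]
  push_cast
  ring

end Count

section Series

open PowerSeries

/-- The power series solution of `R = 1 + 3 * X ^ 4 * R ^ 2`. -/
noncomputable def quadR : ℚ⟦X⟧ :=
  expand 4 (by norm_num) (rescale 3 (catalanSeries.map (Nat.castRingHom ℚ)))

lemma C_three : (C 3 : ℚ⟦X⟧) = 3 := map_ofNat C 3

lemma quadR_sq : quadR ^ 2 * (3 * X ^ 4) + 1 = quadR := by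
  have h := congrArg (fun f => expand 4 (by norm_num)
    (rescale (3 : ℚ) (f.map (Nat.castRingHom ℚ)))) catalanSeries_sq_mul_X_add_one
  simp only [map_add, map_mul, map_pow, map_one, map_X, rescale_X, expand_X, expand_C] at h
  exact h

lemma coeff_quadR (n : ℕ) : coeff (4 * n) quadR = 3 ^ n * catalan n := by
  rw [quadR, coeff_expand_mul, coeff_rescale, coeff_map, catalanSeries_coeff]
  simp

lemma coeff_quadR_sq (n : ℕ) : coeff (4 * n) (quadR ^ 2 : ℚ⟦X⟧) = 3 ^ n * catalan (n + 1) := by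
  have h := congrArg (coeff (4 * n + 4)) quadR_sq
  rw [map_add, coeff_one, if_neg (by omega), add_zero, ← mul_assoc, coeff_mul_X_pow,
    show 4 * n + 4 = 4 * (n + 1) by ring, coeff_quadR,
    ← C_three, coeff_mul_C] at h
  rw [pow_succ 3 n] at h
  linarith

/-- The linear factor in the series of quadrangulations with a boundary. -/
noncomputable def quadA (p : ℕ) : ℚ⟦X⟧ :=
  C ((2 * catalan p + catalan (p + 1) : ℚ) / 3) - C ((catalan (p + 1) - catalan p : ℚ) / 3) * quadR

/-- The series of quadrangulations with a boundary of length `2 * p`, with respect to the number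
of darts. -/
noncomputable def quadF (p : ℕ) : ℚ⟦X⟧ := X ^ (2 * p) * quadR ^ p * quadA p

lemma sum_catalan (p : ℕ) :
    ∑ ab ∈ Finset.HasAntidiagonal.antidiagonal p, (catalan ab.1 : ℚ) * catalan ab.2 = catalan (p + 1) := by
  rw [catalan_succ']
  push_cast
  rfl

lemma sum_catalan_succ_right (p : ℕ) :
    ∑ ab ∈ Finset.HasAntidiagonal.antidiagonal p, (catalan ab.1 : ℚ) * catalan (ab.2 + 1) =
      catalan (p + 2) - catalan (p + 1) := by
  have h := sum_catalan (p + 1)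
  rw [Finset.Nat.sum_antidiagonal_succ'] at h
  simp only [catalan_zero] at h
  push_cast at h
  linarith

lemma sum_catalan_succ_left (p : ℕ) :
    ∑ ab ∈ Finset.HasAntidiagonal.antidiagonal p, (catalan (ab.1 + 1) : ℚ) * catalan ab.2 =
      catalan (p + 2) - catalan (p + 1) := by
  have h := sum_catalan (p + 1)
  rw [Finset.Nat.sum_antidiagonal_succ] at h
  simp only [catalan_zero] at h
  push_cast at h
  linarith

lemma sum_catalan_succ_succ (p : ℕ) :
    ∑ ab ∈ Finset.HasAntidiagonal.antidiagonal p, (catalan (ab.1 + 1) : ℚ) * catalan (ab.2 + 1) =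
      catalan (p + 3) - 2 * catalan (p + 2) := by
  have h := sum_catalan_succ_right (p + 1)
  rw [Finset.Nat.sum_antidiagonal_succ] at h
  simp only [catalan_zero] at h
  push_cast at h
  linarith

lemma sum_quadA_mul (p : ℕ) :
    ∑ ab ∈ Finset.HasAntidiagonal.antidiagonal p, quadA ab.1 * quadA ab.2 + X ^ 4 * quadR ^ 2 * quadA (p + 2) =
      quadR * quadA (p + 1) := by
  have hX : X ^ 4 * quadR ^ 2 = C (1 / 3 : ℚ) * (quadR - 1) := by
    have h3 : C (1 / 3 : ℚ) * 3 = 1 := by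
      rw [← C_three, ← map_mul]; norm_num
    linear_combination C (1 / 3 : ℚ) * quadR_sq - X ^ 4 * quadR ^ 2 * h3
  have hS : ∑ ab ∈ Finset.HasAntidiagonal.antidiagonal p, quadA ab.1 * quadA ab.2 =
      C (1 / 9 * ∑ ab ∈ Finset.HasAntidiagonal.antidiagonal p, (2 * catalan ab.1 + catalan (ab.1 + 1) : ℚ) *
        (2 * catalan ab.2 + catalan (ab.2 + 1))) -
      C (1 / 9 * ∑ ab ∈ Finset.HasAntidiagonal.antidiagonal p,
        ((2 * catalan ab.1 + catalan (ab.1 + 1) : ℚ) * (catalan (ab.2 + 1) - catalan ab.2) +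
        (2 * catalan ab.2 + catalan (ab.2 + 1) : ℚ) * (catalan (ab.1 + 1) - catalan ab.1))) * quadR +
      C (1 / 9 * ∑ ab ∈ Finset.HasAntidiagonal.antidiagonal p, (catalan (ab.1 + 1) - catalan ab.1 : ℚ) *
        (catalan (ab.2 + 1) - catalan ab.2)) * quadR ^ 2 := by
    rw [Finset.mul_sum, Finset.mul_sum, Finset.mul_sum, map_sum, map_sum, map_sum,
      Finset.sum_mul, Finset.sum_mul, ← Finset.sum_sub_distrib, ← Finset.sum_add_distrib]
    refine Finset.sum_congr rfl fun ab _ => ?_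
    unfold quadA
    simp only [div_eq_mul_inv, map_mul, map_add, map_sub]
    have h9 : C (9⁻¹ : ℚ) = C (3⁻¹ : ℚ) * C (3⁻¹ : ℚ) := by rw [← map_mul]; norm_num
    rw [map_one, h9]
    ring
  have e0 := sum_catalan p
  have e1 := sum_catalan_succ_right p
  have e2 := sum_catalan_succ_left p
  have e3 := sum_catalan_succ_succ p
  have s1 : ∑ ab ∈ Finset.HasAntidiagonal.antidiagonal p, (2 * catalan ab.1 + catalan (ab.1 + 1) : ℚ) *
        (2 * catalan ab.2 + catalan (ab.2 + 1)) = catalan (p + 3) + 2 * catalan (p + 2) := by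
    trans 4 * catalan (p + 1) + 2 * (catalan (p + 2) - catalan (p + 1)) +
      2 * (catalan (p + 2) - catalan (p + 1)) + (catalan (p + 3) - 2 * catalan (p + 2) : ℚ)
    · rw [← e3]; nth_rw 1 [← e2]; rw [← e1, ← e0]
      simp only [Finset.mul_sum, ← Finset.sum_add_distrib]
      exact Finset.sum_congr rfl fun _ _ => by ring
    · ring
  have s2 : ∑ ab ∈ Finset.HasAntidiagonal.antidiagonal p,
        ((2 * catalan ab.1 + catalan (ab.1 + 1) : ℚ) * (catalan (ab.2 + 1) - catalan ab.2) +
        (2 * catalan ab.2 + catalan (ab.2 + 1) : ℚ) * (catalan (ab.1 + 1) - catalan ab.1)) =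
      2 * catalan (p + 3) - 2 * catalan (p + 2) - 6 * catalan (p + 1) := by
    trans 2 * (catalan (p + 3) - 2 * catalan (p + 2)) + (catalan (p + 2) - catalan (p + 1)) +
      (catalan (p + 2) - catalan (p + 1)) - (4 * catalan (p + 1) : ℚ)
    · rw [← e3]; nth_rw 1 [← e2]; rw [← e1, ← e0]
      simp only [Finset.mul_sum, ← Finset.sum_add_distrib, ← Finset.sum_sub_distrib]
      exact Finset.sum_congr rfl fun _ _ => by ring
    · ring
  have s3 : ∑ ab ∈ Finset.HasAntidiagonal.antidiagonal p, (catalan (ab.1 + 1) - catalan ab.1 : ℚ) *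
        (catalan (ab.2 + 1) - catalan ab.2) =
      catalan (p + 3) - 4 * catalan (p + 2) + 3 * catalan (p + 1) := by
    trans (catalan (p + 3) - 2 * catalan (p + 2)) - (catalan (p + 2) - catalan (p + 1)) -
      (catalan (p + 2) - catalan (p + 1)) + (catalan (p + 1) : ℚ)
    · rw [← e3]; nth_rw 1 [← e2]; rw [← e1, ← e0]
      simp only [← Finset.sum_add_distrib, ← Finset.sum_sub_distrib]
      exact Finset.sum_congr rfl fun _ _ => by ring
    · ring
  rw [hS, hX, s1, s2, s3]
  unfold quadA
  simp only [div_eq_mul_inv, map_mul, map_add, map_sub, one_mul, map_ofNat]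
  have h9 : C (9⁻¹ : ℚ) * 3 = C (3⁻¹ : ℚ) := by
    rw [← C_three, ← map_mul]; norm_num
  have h1 : C (9⁻¹ : ℚ) * 9 = 1 := by
    rw [← map_ofNat (C (R := ℚ)) 9, ← map_mul]; norm_num
  rw [← h9]
  linear_combination - C (9⁻¹ : ℚ) * (C (catalan (p + 3) : ℚ) * (1 - quadR) ^ 2 +
    C (catalan (p + 2) : ℚ) * (2 - quadR - quadR ^ 2)) * h1

lemma quadF_zero : quadF 0 = 1 := by
  simp only [quadF, quadA, mul_zero, pow_zero, catalan_zero, zero_add, catalan_one]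
  norm_num

lemma quadF_succ (p : ℕ) :
    quadF (p + 1) = X ^ 2 * (∑ ab ∈ Finset.HasAntidiagonal.antidiagonal p, quadF ab.1 * quadF ab.2 +
      quadF (p + 2)) := by
  have h : ∑ ab ∈ Finset.HasAntidiagonal.antidiagonal p, quadF ab.1 * quadF ab.2 =
      X ^ (2 * p) * quadR ^ p * ∑ ab ∈ Finset.HasAntidiagonal.antidiagonal p, quadA ab.1 * quadA ab.2 := by
    rw [Finset.mul_sum]
    refine Finset.sum_congr rfl fun ab hab => ?_
    rw [← Finset.HasAntidiagonal.mem_antidiagonal.1 hab]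
    unfold quadF
    ring
  rw [h]
  unfold quadF
  linear_combination - X ^ (2 * p + 2) * quadR ^ p * sum_quadA_mul p

/-- The number of quadrangulations with a boundary of length `2 * p` and `m` darts. -/
noncomputable def quadCoeff (m p : ℕ) : ℚ := coeff m (quadF p)

lemma quadCoeff_eq_zero {m p : ℕ} (h : m < 2 * p) : quadCoeff m p = 0 := by
  rw [quadCoeff, quadF, mul_assoc, coeff_X_pow_mul', if_neg h.not_ge]

lemma quadCoeff_zero (m : ℕ) : quadCoeff m 0 = if m = 0 then 1 else 0 := by
  rw [quadCoeff, quadF_zero, coeff_one]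

lemma quadCoeff_succ (m p : ℕ) : quadCoeff (m + 2) (p + 1) =
    ∑ ij ∈ Finset.HasAntidiagonal.antidiagonal m, ∑ ab ∈ Finset.HasAntidiagonal.antidiagonal p,
      quadCoeff ij.1 ab.1 * quadCoeff ij.2 ab.2 + quadCoeff m (p + 2) := by
  unfold quadCoeff
  rw [quadF_succ, coeff_X_pow_mul, map_add, map_sum, Finset.sum_comm]
  simp only [coeff_mul]

lemma quadCoeff_two {n : ℕ} (hn : 1 ≤ n) :
    quadCoeff (4 * n) 2 = 2 / (n + 2) * (3 ^ n / (n + 1)) * Nat.choose (2 * n) n := by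
  have h3 : C (1 / 3 : ℚ) * 3 = 1 := by
    rw [← C_three, ← map_mul]; norm_num
  have hA : quadA 2 = 3 - quadR := by
    rw [quadA, catalan_two, catalan_three, ← C_three]
    norm_num
  have hF : quadF 2 = C (1 / 3 : ℚ) * (C 4 * quadR - quadR ^ 2 - C 3) := by
    rw [quadF, hA]
    simp only [map_ofNat]
    linear_combination C (1 / 3 : ℚ) * (3 - quadR) * quadR_sq -
      X ^ 4 * quadR ^ 2 * (3 - quadR) * h3
  have h1 : ((n : ℚ) + 1) * catalan n = Nat.choose (2 * n) n := by
    exact_mod_cast succ_mul_catalan_eq_centralBinom n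
  have h2 : ((n : ℚ) + 2) * catalan (n + 1) = 2 * (2 * n + 1) * catalan n := by
    have e1 : ((n : ℚ) + 1 + 1) * catalan (n + 1) = Nat.centralBinom (n + 1) := by
      exact_mod_cast succ_mul_catalan_eq_centralBinom (n + 1)
    have e2 : ((n : ℚ) + 1) * Nat.centralBinom (n + 1) = 2 * (2 * n + 1) * Nat.centralBinom n := by
      exact_mod_cast Nat.succ_mul_centralBinom_succ n
    have e3 : ((n : ℚ) + 1) * catalan n = Nat.centralBinom n := h1
    have e4 : ((n : ℚ) + 1) ≠ 0 := by positivity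
    apply mul_left_cancel₀ e4
    rw [← e1, ← e3] at e2
    linear_combination e2
  rw [quadCoeff, hF, coeff_C_mul, map_sub, map_sub, coeff_C_mul, coeff_quadR, coeff_quadR_sq,
    coeff_C, if_neg (by omega), ← h1]
  field_simp
  linear_combination - 3 ^ n * h2

end Series

section AddPoint

variable {Y : Type*}

lemma comp_optionCongr_le (φ α : Perm Y) : comp (optionCongr φ : Perm (Option Y)) (optionCongr α) ≤
    Setoid.ker (Option.map (Quotient.mk (comp φ α))) := by
  have h : ∀ π : Perm Y, (cyc π ≤ comp φ α) → cyc (optionCongr π : Perm (Option Y)) ≤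
      Setoid.ker (Option.map (Quotient.mk (comp φ α))) := by
    intro π hπ
    refine cyc_le_iff.2 fun x => ?_
    cases x with
    | none => rfl
    | some x => exact congrArg some (Quotient.sound (hπ (cyc_apply π x)))
  exact sup_le (h φ le_sup_left) (h α le_sup_right)

lemma comp_optionCongr_some {φ α : Perm Y} {x y : Y} :
    comp (optionCongr φ : Perm (Option Y)) (optionCongr α) (some x) (some y) ↔ comp φ α x y := by
  constructor
  · intro h
    have := comp_optionCongr_le φ α h
    exact Quotient.exact (Option.some.inj this)
  · intro h
    have : comp φ α ≤ Setoid.comap some (comp (optionCongr φ : Perm (Option Y)) (optionCongr α)) :=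
      sup_le (cyc_le_iff.2 fun x => sup_left_rel (cyc_apply (optionCongr φ) (some x)))
        (cyc_le_iff.2 fun x => sup_right_rel (cyc_apply (optionCongr α) (some x)))
    exact this h

lemma cyc_optionCongr_some {φ : Perm Y} {x y : Y} :
    cyc (optionCongr φ : Perm (Option Y)) (some x) (some y) ↔ cyc φ x y := by
  rw [← comp_one, ← comp_one φ, ← comp_optionCongr_some (φ := φ) (α := 1),
    show (1 : Perm Y) = Equiv.refl Y from rfl, optionCongr_refl]

lemma cyc_optionCongr_none {φ : Perm Y} {x : Option Y}
    (h : cyc (optionCongr φ : Perm (Option Y)) none x) : x = none :=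
  (fixed_of_cyc (by simp) h).symm

lemma classSize_some {s : Setoid (Option Y)} {t : Setoid Y} (h0 : ∀ x, s none x → x = none)
    (h : ∀ x y, s (some x) (some y) ↔ t x y) (x : Y) : classSize s (some x) = classSize t x := by
  refine Nat.card_congr
    ⟨fun y => ⟨y.1.get ?_, ?_⟩, fun y => ⟨some y.1, (h _ _).2 y.2⟩, fun y => ?_, fun y => ?_⟩
  · obtain ⟨_ | y, hy⟩ := y
    · exact absurd (h0 _ (s.symm hy)) (by simp)
    · simp
  · rw [← h]
    simpa using y.2
  · simp
  · simp

lemma numClasses_option [Finite Y] {s : Setoid (Option Y)} {t : Setoid Y}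
    (h0 : ∀ x, s none x → x = none) (h : ∀ x y, s (some x) (some y) ↔ t x y) :
    numClasses s = numClasses t + 1 := by
  have := Fintype.ofFinite Y
  have key : (numClasses s : ℚ) = numClasses t + 1 := by
    rw [numClasses_eq_sum, numClasses_eq_sum, Fintype.sum_option,
      classSize_eq_one fun y hy => (h0 y hy).symm]
    simp only [classSize_some h0 h]
    simp [add_comm]
  exact_mod_cast key

lemma planar_optionCongr [Finite Y] {φ α : Perm Y} :
    Planar (optionCongr φ : Perm (Option Y)) (optionCongr α) ↔ Planar φ α := by
  have h : ∀ π : Perm Y, numClasses (cyc (optionCongr π : Perm (Option Y))) =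
      numClasses (cyc π) + 1 := fun π =>
    numClasses_option (fun x => cyc_optionCongr_none) fun x y => cyc_optionCongr_some
  have h1 : numClasses (comp (optionCongr φ : Perm (Option Y)) (optionCongr α)) =
      numClasses (comp φ α) + 1 :=
    numClasses_option (fun x hx => (comp_fixed (by simp) (by simp) hx).symm)
      fun x y => comp_optionCongr_some
  have h2 : (optionCongr φ * optionCongr α : Perm (Option Y)) = optionCongr (φ * α) := by
    ext x
    cases x <;> simp
  unfold Planar
  rw [h2, h, h, h, h1, Finite.card_option]
  omega

/-- Quadrangulations rooted at a dart correspond to quadrangulations with a leg in a face of degree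
five. -/
lemma isQ_option_iff [Fintype Y] [DecidableEq Y] {φ α : Perm Y} {r : Y} :
    IsQ Finset.univ none 2 (swap none (some r) * optionCongr φ) (optionCongr α) ↔
      (∀ x, α (α x) = x) ∧ (∀ x, α x ≠ x) ∧ (∀ x y, comp φ α x y) ∧ Planar φ α ∧
        ∀ x, classSize (cyc φ) x = 4 := by
  obtain ⟨b, rfl⟩ := φ.surjective r
  have e : swap none (some (φ b)) * optionCongr φ = optionCongr φ * swap (some b) none := by
    rw [Equiv.mul_swap_eq_swap_mul, swap_comm]
    simp
  have hb : some b ≠ none := by simp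
  have hcyc : cyc (optionCongr φ * swap (some b) none) =
      cyc (optionCongr φ) ⊔ cyc (swap (some b) none) := cyc_mul_swap_fixed (by simp) hb
  have hnot : ¬ cyc (optionCongr φ) (some b) none := fun h =>
    hb (cyc_optionCongr_none (Setoid.symm' _ h))
  have hsize : ∀ x, classSize (cyc (optionCongr φ)) (some x) = classSize (cyc φ) x :=
    classSize_some (fun x => cyc_optionCongr_none) fun x y => cyc_optionCongr_some
  have hroot : classSize (cyc (optionCongr φ * swap (some b) none)) none =
      classSize (cyc φ) b + 1 := by
    rw [hcyc, ← classSize_eq_of_rel (sup_right_rel (cyc_swap_rel (some b) none)),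
      classSize_sup_swap hnot, hsize,
      classSize_eq_one fun y hy => (cyc_optionCongr_none hy).symm]
  have hrel : ∀ x, cyc (optionCongr φ * swap (some b) none) none (some x) ↔ cyc φ b x := by
    intro x
    rw [hcyc, sup_swap_rel, ← cyc_optionCongr_some (φ := φ)]
    constructor
    · rintro (h | ⟨h, _⟩ | ⟨_, h⟩)
      · exact absurd (cyc_optionCongr_none h) (by simp)
      · exact absurd (cyc_optionCongr_none h) (by simp)
      · exact h
    · exact fun h => Or.inr (Or.inr ⟨Setoid.refl' _ _, h⟩)
  have hother : ∀ x, ¬ cyc φ b x → classSize (cyc (optionCongr φ * swap (some b) none)) (some x) =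
      classSize (cyc φ) x := by
    intro x hx
    rw [hcyc, ← hsize]
    refine classSize_congr (sup_swap_rel_of_not (fun h => hx ?_) fun h => ?_)
    · exact Setoid.symm' _ (cyc_optionCongr_some.1 h)
    · exact absurd (cyc_optionCongr_none (Setoid.symm' _ h)) (by simp)
  have hmap : IsMap Finset.univ {none} (optionCongr φ * swap (some b) none) (optionCongr α) ↔
      IsMap (Finset.univ.erase none) ∅ (optionCongr φ : Perm (Option Y)) (optionCongr α) := by
    rw [← isMap_insert (S := Finset.univ.erase none) (L := ∅) (s := none) (b := some b) (by simp)
      (by simp) (by simp) (by simp), Finset.insert_erase (Finset.mem_univ _)]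
    rfl
  have hmap' : IsMap (Finset.univ.erase none) ∅ (optionCongr φ : Perm (Option Y)) (optionCongr α) ↔
      (∀ x, α (α x) = x) ∧ (∀ x, α x ≠ x) ∧ (∀ x y, comp φ α x y) ∧ Planar φ α := by
    constructor
    · refine fun h => ⟨fun x => ?_, fun x hx => ?_, fun x y => ?_, planar_optionCongr.1 h.planar⟩
      · simpa using h.α_inv (some x)
      · simpa using (h.fixed (some x) (by simp)).1 (by simp [hx])
      · exact comp_optionCongr_some.1 (h.conn (some x) (by simp) (some y) (by simp))
    · rintro ⟨h1, h2, h3, h4⟩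
      refine ⟨fun x hx => ?_, fun x hx => ?_, fun x => ?_, fun x hx => ?_, fun x hx y hy => ?_,
        planar_optionCongr.2 h4⟩
      · simp only [Finset.mem_erase, Finset.mem_univ, and_true, not_not] at hx
        simp [hx]
      · simp only [Finset.mem_erase, Finset.mem_univ, and_true, not_not] at hx
        simp [hx]
      · cases x <;> simp [h1]
      · obtain _ | x := x
        · simp at hx
        · simp [h2]
      · obtain _ | x := x
        · simp at hx
        · obtain _ | y := y
          · simp at hy
          · exact comp_optionCongr_some.2 (h3 x y)
  rw [e]
  constructor
  · intro h
    obtain ⟨h1, h2, h3, h4⟩ := hmap'.1 (hmap.1 h.map)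
    refine ⟨h1, h2, h3, h4, fun x => ?_⟩
    have h5 := h.root
    rw [hroot] at h5
    by_cases hx : cyc φ b x
    · rw [← classSize_eq_of_rel hx]
      omega
    · rw [← hother x hx]
      exact h.quad _ (Finset.mem_univ _) fun h' => hx ((hrel x).1 h')
  · rintro ⟨h1, h2, h3, h4, h5⟩
    refine ⟨hmap.2 (hmap'.2 ⟨h1, h2, h3, h4⟩), Finset.mem_univ _, by rw [hroot, h5],
      fun x _ hx => ?_⟩
    obtain _ | x := x
    · exact absurd (Setoid.refl' _ _) hx
    · rw [hother x fun h' => hx ((hrel x).2 h'), h5]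

end AddPoint

section RootedMaps

lemma orbitCount_eq {m : ℕ} (π : Perm (Fin m)) : orbitCount π = numClasses (cyc π) := by
  refine Nat.card_congr (Quotient.congrRight fun x y => ?_)
  rw [MulAction.orbitRel_apply, MulAction.mem_orbit_iff]
  constructor
  · rintro ⟨⟨_, k, rfl⟩, hk⟩
    exact SameCycle.symm ⟨k, hk⟩
  · intro h
    obtain ⟨k, hk⟩ := SameCycle.symm h
    exact ⟨⟨π ^ k, k, rfl⟩, hk⟩

lemma connected_iff {Y : Type*} {σ α : Perm Y} (hα : ∀ x, α (α x) = x) {x y : Y} :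
    (∃ g ∈ Subgroup.closure ({σ, α} : Set (Perm Y)), g x = y) ↔ comp (σ * α) α x y := by
  have hσα : comp (σ * α) α = comp σ α := by
    have h : σ * α * α = σ := by ext z; simp [hα]
    refine le_antisymm (sup_le (cyc_mul_le _ _) le_sup_right) (sup_le ?_ le_sup_right)
    conv_lhs => rw [← h]
    exact cyc_mul_le _ _
  rw [hσα]
  constructor
  · rintro ⟨g, hg, rfl⟩
    induction hg using Subgroup.closure_induction generalizing x with
    | mem g hg =>
      rcases hg with rfl | rfl
      · exact sup_left_rel (cyc_apply _ _)
      · exact sup_right_rel (cyc_apply _ _)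
    | one => exact Setoid.refl' _ _
    | mul g h _ _ hg hh => exact Setoid.trans' _ hh hg
    | inv g _ hg => simpa using Setoid.symm' _ (hg (x := g⁻¹ x))
  · intro h
    let s : Setoid Y := (MulAction.orbitRel (Subgroup.closure ({σ, α} : Set (Perm Y))) Y)
    have hs : ∀ g ∈ ({σ, α} : Set (Perm Y)), cyc g ≤ s := fun g hg => cyc_le_iff.2 fun z =>
      s.symm ⟨⟨g, Subgroup.subset_closure hg⟩, rfl⟩
    have : s x y := (sup_le (hs σ (by simp)) (hs α (by simp)) : comp σ α ≤ s) h
    obtain ⟨g, hg⟩ := s.symm this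
    exact ⟨g.1, g.2, hg⟩

lemma isPlanarQuad_iff {n : ℕ} (M : RootedMap (4 * n)) :
    IsPlanarQuad M ↔ Planar (M.σ * M.α) M.α ∧ ∀ d, classSize (cyc (M.σ * M.α)) d = 4 := by
  have h1 : (numClasses (cyc M.α) : ℚ) = 2 * n := by
    have h : ∀ d, classSize (cyc M.α) d = 2 := fun d => by
      rw [classSize_cyc]
      have := Fact.mk Nat.prime_two
      exact Function.minimalPeriod_eq_prime (M.α_invol d) (M.α_fpf d)
    rw [numClasses_eq_sum]
    simp only [h, Finset.sum_const, Finset.card_univ, Fintype.card_fin, nsmul_eq_mul]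
    push_cast
    ring
  replace h1 : numClasses (cyc M.α) = 2 * n := by exact_mod_cast h1
  have h2 : numClasses (comp (M.σ * M.α) M.α) = 1 := by
    rw [numClasses, Nat.card_eq_one_iff_unique]
    refine ⟨⟨fun a b => ?_⟩, ⟨Quotient.mk _ M.root⟩⟩
    induction a, b using Quotient.inductionOn₂ with
    | _ a b => exact Quotient.sound ((connected_iff M.α_invol).1 (M.connected a b))
  have h3 : M.σ * M.α * M.α = M.σ := by ext z; simp [M.α_invol]
  unfold IsPlanarQuad Planar
  rw [orbitCount_eq, orbitCount_eq, h1, h2, h3, Nat.card_eq_fintype_card, Fintype.card_fin,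
    and_comm]
  refine and_congr (by omega) (forall_congr' fun d => ?_)
  rw [classSize_cyc_eq_four_iff]
  refine ⟨fun h => ⟨h.1, h.2.2⟩, fun h => ⟨h.1, fun h' => h.2 ?_, h.2⟩⟩
  rw [pow_two, Perm.mul_apply, h', h']

lemma rootedMap_ext {D : ℕ} {M M' : RootedMap D} (h1 : M.σ = M'.σ) (h2 : M.α = M'.α)
    (h3 : M.root = M'.root) : M = M' := by
  cases M
  cases M'
  simp_all

lemma isQ_of_isPlanarQuad {n : ℕ} {M : RootedMap (4 * n)} (h : IsPlanarQuad M) :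
    IsQ Finset.univ none 2 (swap none (some M.root) * optionCongr (M.σ * M.α))
      (optionCongr M.α) :=
  isQ_option_iff.2 ⟨M.α_invol, M.α_fpf,
    fun x y => (connected_iff M.α_invol).1 (M.connected x y), (isPlanarQuad_iff M).1 h⟩

lemma card_planarQuad (n : ℕ) : Nat.card {M : RootedMap (4 * n) // IsPlanarQuad M} =
    (quadSet (Finset.univ : Finset (Option (Fin (4 * n)))) none 2).card := by
  rw [← Nat.card_eq_finsetCard]
  refine Nat.card_congr (Equiv.ofBijective (fun M => ⟨(swap none (some M.1.root) *
    optionCongr (M.1.σ * M.1.α), optionCongr M.1.α), mem_quadSet.2 (isQ_of_isPlanarQuad M.2)⟩)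
    ⟨fun M M' h => ?_, ?_⟩)
  · rw [Subtype.mk.injEq, Prod.mk.injEq] at h
    obtain ⟨h1, h2⟩ := h
    have h3 : M.1.α = M'.1.α := optionCongr_injective h2
    have h4 : M.1.root = M'.1.root := by
      have := Equiv.congr_fun h1 none
      simpa using this
    rw [h4, h3] at h1
    exact Subtype.ext (rootedMap_ext
      (mul_right_cancel (optionCongr_injective (mul_left_cancel h1))) h3 h4)
  · rintro ⟨⟨φ', α'⟩, h⟩
    rw [mem_quadSet] at h
    obtain ⟨⟨i, φ⟩, rfl⟩ := decomposeOption.symm.surjective φ'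
    obtain ⟨⟨j, α⟩, rfl⟩ := decomposeOption.symm.surjective α'
    simp only [decomposeOption_symm_apply] at h
    have hj : j = none := by simpa using h.apply_leg
    subst hj
    have hi : none ≠ i := by simpa using (h.apply_root rfl rfl).2.2.1
    obtain _ | r := i
    · exact absurd rfl hi
    have hα : swap none none * optionCongr α = optionCongr α := by rw [swap_self]; rfl
    rw [hα] at h
    obtain ⟨h1, h2, h3, h4, h5⟩ := isQ_option_iff.1 h
    have h6 : φ * α * α = φ := by ext z; simp [h1]
    let M : RootedMap (4 * n) := ⟨φ * α, α, r, h1, h2, fun x y => by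
      rw [connected_iff h1, h6]; exact h3 x y⟩
    refine ⟨⟨M, (isPlanarQuad_iff M).2 ?_⟩, ?_⟩
    · simp only [M, h6]
      exact ⟨h4, h5⟩
    · simp only [M, h6, decomposeOption_symm_apply, hα]

end RootedMaps

section Isomorphism

lemma mapIso_eq {D : ℕ} {M : RootedMap D} {e : Perm (Fin D)} (h1 : ∀ d, e (M.σ d) = M.σ (e d))
    (h2 : ∀ d, e (M.α d) = M.α (e d)) (h3 : e M.root = M.root) : e = 1 := by
  ext1 d
  obtain ⟨g, hg, rfl⟩ := M.connected M.root d
  have key : Subgroup.closure ({M.σ, M.α} : Set (Perm (Fin D))) ≤ Subgroup.centralizer {e} := by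
    rw [Subgroup.closure_le]
    rintro g (rfl | rfl)
    · exact Subgroup.mem_centralizer_singleton_iff.2 (Equiv.ext h1).symm
    · exact Subgroup.mem_centralizer_singleton_iff.2 (Equiv.ext h2).symm
  have := Equiv.congr_fun (Subgroup.mem_centralizer_singleton_iff.1 (key hg)) M.root
  simp only [Perm.mul_apply, h3] at this
  exact this.symm

lemma numClasses_conj {Y : Type*} (e π : Perm Y) :
    numClasses (cyc (e * π * e⁻¹)) = numClasses (cyc π) := by
  refine (Nat.card_congr (Quotient.congr e fun x y => ?_)).symm
  change cyc π x y ↔ cyc (e * π * e⁻¹) (e x) (e y)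
  rw [cyc_rel, cyc_rel, sameCycle_conj]
  simp

lemma classSize_conj {Y : Type*} (e π : Perm Y) (x : Y) :
    classSize (cyc (e * π * e⁻¹)) x = classSize (cyc π) (e⁻¹ x) := by
  refine Nat.card_congr (Equiv.subtypeEquiv e⁻¹ fun y => ?_)
  rw [cyc_rel, cyc_rel, sameCycle_conj]

/-- Relabelling the darts of a rooted map. -/
def relabel {D : ℕ} (e : Perm (Fin D)) (M : RootedMap D) : RootedMap D where
  σ := e * M.σ * e⁻¹
  α := e * M.α * e⁻¹
  root := e M.root
  α_invol d := by simp [M.α_invol]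
  α_fpf d h := M.α_fpf (e⁻¹ d) (e.injective (by simpa using h))
  connected d d' := by
    obtain ⟨g, hg, h⟩ := M.connected (e⁻¹ d) (e⁻¹ d')
    refine ⟨e * g * e⁻¹, ?_, by rw [Perm.mul_apply, Perm.mul_apply, h]; simp⟩
    have := Subgroup.mem_map_of_mem (MulAut.conj e).toMonoidHom hg
    rw [MonoidHom.map_closure, Set.image_pair] at this
    exact this

lemma isPlanarQuad_relabel {n : ℕ} {M : RootedMap (4 * n)} (e : Perm (Fin (4 * n)))
    (h : IsPlanarQuad M) : IsPlanarQuad (relabel e M) := by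
  have h1 : (relabel e M).σ * (relabel e M).α = e * (M.σ * M.α) * e⁻¹ := by
    simp [relabel, mul_assoc]
  have h2 : ∀ d, classSize (cyc ((relabel e M).σ * (relabel e M).α)) d = 4 := fun d => by
    rw [h1, classSize_conj, ((isPlanarQuad_iff M).1 h).2]
  have h3 : orbitCount (relabel e M).σ = orbitCount M.σ := by
    rw [orbitCount_eq, orbitCount_eq]
    exact numClasses_conj e M.σ
  have h4 : orbitCount ((relabel e M).σ * (relabel e M).α) = orbitCount (M.σ * M.α) := by
    rw [h1, orbitCount_eq, orbitCount_eq, numClasses_conj]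
  refine ⟨fun d => ?_, by rw [h3, h4]; exact h.2⟩
  have h5 := classSize_cyc_eq_four_iff.1 (h2 d)
  refine ⟨h5.1, fun h' => h5.2 ?_, h5.2⟩
  rw [pow_two, Perm.mul_apply, h', h']

instance (n : ℕ) : MulAction (Perm (Fin (4 * n))) {M : RootedMap (4 * n) // IsPlanarQuad M} where
  smul e M := ⟨relabel e M.1, isPlanarQuad_relabel e M.2⟩
  one_smul M := Subtype.ext (rootedMap_ext (one_mul _) (one_mul _) rfl)
  mul_smul e e' M := Subtype.ext (rootedMap_ext
    (by change _ * _ * _ = _ * (_ * _ * _) * _; simp [mul_assoc])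
    (by change _ * _ * _ = _ * (_ * _ * _) * _; simp [mul_assoc]) rfl)

lemma relabel_eq_iff {D : ℕ} {M M' : RootedMap D} {e : Perm (Fin D)} :
    relabel e M = M' ↔
      (∀ d, e (M.σ d) = M'.σ (e d)) ∧ (∀ d, e (M.α d) = M'.α (e d)) ∧ e M.root = M'.root := by
  constructor
  · rintro rfl
    simp [relabel]
  · rintro ⟨h1, h2, h3⟩
    refine rootedMap_ext (Equiv.ext fun d => ?_) (Equiv.ext fun d => ?_) h3
    · simp [relabel, h1]
    · simp [relabel, h2]

lemma card_planarQuad_eq_mul (n : ℕ) : Nat.card {M : RootedMap (4 * n) // IsPlanarQuad M} =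
    (4 * n).factorial * Nat.card (Quot (fun M M' : {M : RootedMap (4 * n) // IsPlanarQuad M} =>
        MapIso M.1 M'.1)) := by
  have hfree : ∀ M : {M : RootedMap (4 * n) // IsPlanarQuad M},
      MulAction.stabilizer (Perm (Fin (4 * n))) M = ⊥ := by
    refine fun M => (Subgroup.eq_bot_iff_forall _).2 fun e he => ?_
    obtain ⟨h1, h2, h3⟩ := relabel_eq_iff.1 (congrArg Subtype.val he)
    exact mapIso_eq h1 h2 h3
  have hquot : Nat.card (Quot (fun M M' : {M : RootedMap (4 * n) // IsPlanarQuad M} =>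
      MapIso M.1 M'.1)) = Nat.card (MulAction.orbitRel.Quotient (Perm (Fin (4 * n)))
        {M : RootedMap (4 * n) // IsPlanarQuad M}) := by
    refine Nat.card_congr (Quot.congrRight fun M M' => ?_)
    rw [Setoid.comm', MulAction.orbitRel_apply, MulAction.mem_orbit_iff]
    exact exists_congr fun e => by rw [← relabel_eq_iff, Subtype.ext_iff]; rfl
  rw [Nat.card_congr (MulAction.selfEquivOrbitsQuotientProd hfree), Nat.card_prod, ← hquot,
    mul_comm, Nat.card_perm, Nat.card_eq_fintype_card, Fintype.card_fin]

end Isomorphism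

end PlanarQuad

/-- The number of rooted planar quadrangulations with `n` faces equals
`(2/(n+2)) · (3^n/(n+1)) · binomial(2n, n)`. -/
theorem stmt_4 (n : ℕ) (hn : 1 ≤ n) :
    (Nat.card (Quot (fun M M' : {M : RootedMap (4 * n) // IsPlanarQuad M} =>
        MapIso M.1 M'.1)) : ℚ)
      = 2 / (n + 2) * (3 ^ n / (n + 1)) * Nat.choose (2 * n) n := by
  have h := PlanarQuad.card_quadSet (f := PlanarQuad.quadCoeff)
    (by simp [PlanarQuad.quadCoeff_zero]) (fun p => PlanarQuad.quadCoeff_eq_zero (by omega))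
    (fun p => PlanarQuad.quadCoeff_eq_zero (by omega)) (by simp [PlanarQuad.quadCoeff_zero])
    PlanarQuad.quadCoeff_succ (4 * n) (Finset.univ : Finset (Option (Fin (4 * n)))) none 2
    (Finset.mem_univ _) (by simp)
  rw [← PlanarQuad.card_planarQuad, PlanarQuad.card_planarQuad_eq_mul, Nat.cast_mul] at h
  rw [← PlanarQuad.quadCoeff_two hn]
  exact mul_left_cancel₀ (by exact_mod_cast Nat.factorial_ne_zero _) h
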